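/- arXiv:1109.3778 — 15 statements merged into one kernel-verified Lean document; each statement's English description precedes it below -/
import Mathlib

section
/- Let n, r be natural numbers with 0 < r < n, let E, A be n×n real matrices with rank(E) = r, and suppose there exists λ ∈ ℝ such that λ•E + A is invertible. Then there exist an invertible n×n real matrix U, an n×n permutation matrix P, and matrices S, K ∈ ℝ^{r×r}, T, L ∈ ℝ^{r×(n−r)}, M ∈ ℝ^{(n−r)×r}, N ∈ ℝ^{(n−r)×(n−r)} with N invertible, such that E = U * (fromBlocks S T 0 0) * P⁻¹ and A = U * (fromBlocks K L M N) * P⁻¹ (identifying Fin n with Fin r ⊕ Fin (n−r) so that n×n matrices can be written in block form via Matrix.fromBlocks). In particular λ•E + A = U * (fromBlocks (λ•S + K) (λ•T + L) M N) * P⁻¹. -/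
open Matrix

/-- The canonical identification `Fin r ⊕ Fin (n - r) ≃ Fin n` when `r ≤ n`. -/
def sumFinEquiv (r n : ℕ) (h : r ≤ n) : Fin r ⊕ Fin (n - r) ≃ Fin n :=
  finSumFinEquiv.trans (finCongr (Nat.add_sub_cancel' h))

/-- Row compression: an invertible change of rows makes the rows outside a chosen set of `rank E`
indices vanish. -/
theorem exists_isUnit_mul_row_eq_zero {F m κ ι : Type*} [Field F] [Fintype m] [DecidableEq m]
    [Fintype κ] [Fintype ι] (e : κ ⊕ ι ≃ m) (E : Matrix m m F)
    (hκ : E.rank = Fintype.card κ) :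
    ∃ V : Matrix m m F, IsUnit V ∧ ∀ j, (V * E).row (e (Sum.inr j)) = 0 := by
  have hm : Fintype.card κ + Fintype.card ι = Fintype.card m := by
    rw [← Fintype.card_sum, Fintype.card_congr e]
  have hrk := LinearMap.finrank_range_add_finrank_ker Eᵀ.mulVecLin
  have hrange : Module.finrank F (LinearMap.range Eᵀ.mulVecLin) = Fintype.card κ :=
    (rank_transpose E).trans hκ
  rw [hrange, Module.finrank_fintype_fun_eq_card] at hrk
  obtain ⟨C, hC⟩ := (LinearMap.ker Eᵀ.mulVecLin).exists_isCompl
  have hCrk := Submodule.finrank_add_eq_of_isCompl hC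
  rw [Module.finrank_fintype_fun_eq_card] at hCrk
  let bC : Module.Basis κ F C :=
    (Module.finBasisOfFinrankEq F C (by omega)).reindex (Fintype.equivFin κ).symm
  let bK : Module.Basis ι F (LinearMap.ker Eᵀ.mulVecLin) :=
    (Module.finBasisOfFinrankEq F _ (by omega)).reindex (Fintype.equivFin ι).symm
  let b : Module.Basis m F (m → F) :=
    ((bC.prod bK).map (Submodule.prodEquivOfIsCompl _ _ hC.symm)).reindex e
  refine ⟨Matrix.of b, linearIndependent_rows_iff_isUnit.1 b.linearIndependent, fun j ↦ ?_⟩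
  have hb : b (e (Sum.inr j)) = bK j := by simp [b]
  have hker : Eᵀ *ᵥ (bK j : m → F) = 0 := LinearMap.mem_ker.1 (bK j).2
  rw [← hb, mulVec_transpose] at hker
  exact hker

/-- The linearly independent rows indexed by `ι` of a matrix admit an invertible square submatrix,
whose columns a permutation brings to any prescribed position. -/
theorem exists_perm_isUnit_submatrix {F m ι : Type*} [Field F] [Fintype m]
    [Fintype ι] [DecidableEq ι] (C : Matrix ι m F) (hC : LinearIndependent F C.row)
    (g : ι → m) (hg : Function.Injective g) :
    ∃ σ : Equiv.Perm m, IsUnit (C.submatrix id (σ ∘ g)) := by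
  obtain ⟨κ, a, ha, hsp, hli⟩ := exists_linearIndependent' F C.col
  have : Finite κ := Finite.of_injective a ha
  have := Fintype.ofFinite κ
  have hcard : Fintype.card ι = Fintype.card κ := by
    rw [← hC.rank_matrix, rank_eq_finrank_span_cols, ← hsp, finrank_span_eq_card hli]
  let w : ι ≃ κ := Fintype.equivOfCardEq hcard
  obtain ⟨σ, hσ⟩ := Equiv.Perm.exists_extending_pair g (a ∘ w) hg (ha.comp w.injective)
  refine ⟨σ, linearIndependent_cols_iff_isUnit.1 ?_⟩
  have hcol : (C.submatrix id (σ ∘ g)).col = (C.col ∘ a) ∘ w := by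
    funext j i
    simpa [col_apply] using congrArg (C i) (hσ j)
  rw [hcol]
  exact hli.comp w w.injective

/-- Lemma 1: block decomposition of a regular pencil `λ • E + A` with `rank E = r`. -/
theorem deflation_block_decomposition (n r : ℕ) (hr : 0 < r) (hrn : r < n)
    (E A : Matrix (Fin n) (Fin n) ℝ) (hrank : E.rank = r)
    (l : ℝ) (hreg : IsUnit (l • E + A)) :
    ∃ (U P : Matrix (Fin n) (Fin n) ℝ)
      (S K : Matrix (Fin r) (Fin r) ℝ)
      (T L : Matrix (Fin r) (Fin (n - r)) ℝ)
      (M : Matrix (Fin (n - r)) (Fin r) ℝ)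
      (N : Matrix (Fin (n - r)) (Fin (n - r)) ℝ),
      IsUnit U ∧
      (∃ σ : Equiv.Perm (Fin n), P = σ.permMatrix ℝ) ∧
      IsUnit N ∧
      E = U * (Matrix.reindex (sumFinEquiv r n hrn.le) (sumFinEquiv r n hrn.le)
            (fromBlocks S T 0 0)) * P⁻¹ ∧
      A = U * (Matrix.reindex (sumFinEquiv r n hrn.le) (sumFinEquiv r n hrn.le)
            (fromBlocks K L M N)) * P⁻¹ ∧
      l • E + A = U * (Matrix.reindex (sumFinEquiv r n hrn.le) (sumFinEquiv r n hrn.le)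
            (fromBlocks (l • S + K) (l • T + L) M N)) * P⁻¹ := by
  let e := sumFinEquiv r n hrn.le
  obtain ⟨V, hV, hVE⟩ := exists_isUnit_mul_row_eq_zero e E (by simpa using hrank)
  have hrows : LinearIndependent ℝ ((V * A).submatrix (e ∘ Sum.inr) id).row := by
    have h := (linearIndependent_rows_iff_isUnit.2 (hV.mul hreg)).comp (e ∘ Sum.inr)
      (e.injective.comp Sum.inr_injective)
    have hrow : ((V * A).submatrix (e ∘ Sum.inr) id).row =
        (V * (l • E + A)).row ∘ e ∘ Sum.inr := by
      funext j k
      have hjk := congrFun (hVE j) k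
      simp only [row_apply, Pi.zero_apply] at hjk
      simp [Matrix.mul_add, hjk]
    rw [hrow]
    exact h
  obtain ⟨σ, hσ⟩ := exists_perm_isUnit_submatrix _ hrows (e ∘ Sum.inr)
    (e.injective.comp Sum.inr_injective)
  let P : Matrix (Fin n) (Fin n) ℝ := σ⁻¹.permMatrix ℝ
  have hP : IsUnit P.det := by
    rw [det_permutation]
    exact (Equiv.Perm.sign σ⁻¹).isUnit.map (Int.castRingHom ℝ)
  have hmul (X : Matrix (Fin n) (Fin n) ℝ) : X * P = X.submatrix id σ :=
    PEquiv.mul_toMatrix_toPEquiv _ _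
  have hVdet := (isUnit_iff_isUnit_det V).1 hV
  have hfac (X R : Matrix (Fin n) (Fin n) ℝ) (h : V * X * P = R) : X = V⁻¹ * R * P⁻¹ := by
    rw [← h, ← Matrix.mul_assoc, mul_nonsing_inv_cancel_right _ _ hP,
      nonsing_inv_mul_cancel_left _ _ hVdet]
  let X := (V * E * P).submatrix e e
  let Y := (V * A * P).submatrix e e
  have hX₂₁ : X.toBlocks₂₁ = 0 := by
    ext i j
    simpa [X, toBlocks₂₁, hmul] using congrFun (hVE i) (σ (e (Sum.inl j)))
  have hX₂₂ : X.toBlocks₂₂ = 0 := by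
    ext i j
    simpa [X, toBlocks₂₂, hmul] using congrFun (hVE i) (σ (e (Sum.inr j)))
  have hX : fromBlocks X.toBlocks₁₁ X.toBlocks₁₂ 0 0 = X := by
    rw [← hX₂₁, ← hX₂₂, fromBlocks_toBlocks]
  have hE : V * E * P = reindex e e (fromBlocks X.toBlocks₁₁ X.toBlocks₁₂ 0 0) := by
    rw [hX]
    simp [X]
  have hA : V * A * P = reindex e e
      (fromBlocks Y.toBlocks₁₁ Y.toBlocks₁₂ Y.toBlocks₂₁ Y.toBlocks₂₂) := by
    rw [fromBlocks_toBlocks]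
    simp [Y]
  refine ⟨V⁻¹, P, X.toBlocks₁₁, Y.toBlocks₁₁, X.toBlocks₁₂, Y.toBlocks₁₂, Y.toBlocks₂₁,
    Y.toBlocks₂₂, (isUnit_nonsing_inv_iff).2 hV, ⟨σ⁻¹, rfl⟩, ?_, hfac _ _ hE, hfac _ _ hA,
    hfac _ _ ?_⟩
  · convert hσ using 1
    ext i j
    simp [Y, toBlocks₂₂, hmul]
  · have hsum : V * (l • E + A) * P = l • (V * E * P) + V * A * P := by
      simp [Matrix.mul_add, Matrix.add_mul]
    have hblocks : fromBlocks (l • X.toBlocks₁₁ + Y.toBlocks₁₁) (l • X.toBlocks₁₂ + Y.toBlocks₁₂)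
        Y.toBlocks₂₁ Y.toBlocks₂₂ = l • fromBlocks X.toBlocks₁₁ X.toBlocks₁₂ 0 0 +
          fromBlocks Y.toBlocks₁₁ Y.toBlocks₁₂ Y.toBlocks₂₁ Y.toBlocks₂₂ := by
      simp [fromBlocks_smul, fromBlocks_add]
    rw [hsum, hE, hA, hblocks]
    rfl
end

section
/- Let r, m be natural numbers and set n = r + m, identifying Fin n with Fin r ⊕ Fin m. Let S, S̃, K, K̃ ∈ ℝ^{r×r}, T, T̃, L, L̃ ∈ ℝ^{r×m}, M, M̃ ∈ ℝ^{m×r}, and N, Ñ ∈ ℝ^{m×m} with N and Ñ invertible. Suppose there is an n×n permutation matrix P₀ such that (fromBlocks S T M N) * P₀ = fromBlocks S̃ T̃ M̃ Ñ and (fromBlocks K L M N) * P₀ = fromBlocks K̃ L̃ M̃ Ñ. Then rank(S − T*N⁻¹*M) = rank(S̃ − T̃*Ñ⁻¹*M̃) and rank(K − L*N⁻¹*M) = rank(K̃ − L̃*Ñ⁻¹*M̃). That is, any two deflated pencils of the same DAE have matrices of equal ranks. -/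
open Matrix

section SchurComplement

variable {𝕜 l m n : Type*} [Field 𝕜] [Fintype m] [Fintype n] [DecidableEq n]

/-- The kernel of a block matrix with invertible lower right block is the graph of `-D⁻¹ * C` over
the kernel of the Schur complement. -/
theorem Matrix.ker_mulVecLin_fromBlocks_eq_map [DecidableEq m] (A : Matrix l m 𝕜)
    (B : Matrix l n 𝕜) (C : Matrix n m 𝕜) (D : Matrix n n 𝕜) (hD : IsUnit D) :
    LinearMap.ker (fromBlocks A B C D).mulVecLin =
      (LinearMap.ker (A - B * D⁻¹ * C).mulVecLin).map
        (fromRows 1 (-(D⁻¹ * C))).mulVecLin := by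
  have hdet := (isUnit_iff_isUnit_det D).mp hD
  ext v
  obtain ⟨x, y, rfl⟩ : ∃ x y, v = Sum.elim x y := ⟨_, _, (Sum.elim_comp_inl_inr v).symm⟩
  have hzero (a : l → 𝕜) (b : n → 𝕜) : Sum.elim a b = 0 ↔ a = 0 ∧ b = 0 := by
    rw [← Sum.elim_zero_zero, Sum.elim_eq_iff]
  have hlower : C *ᵥ x + D *ᵥ y = 0 ↔ -(D⁻¹ * C) *ᵥ x = y := by
    constructor
    · intro h
      rw [neg_mulVec, ← mulVec_mulVec, eq_neg_of_add_eq_zero_left h, mulVec_neg, neg_neg,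
        mulVec_mulVec, nonsing_inv_mul _ hdet, one_mulVec]
    · rintro rfl
      rw [mulVec_mulVec, Matrix.mul_neg, mul_nonsing_inv_cancel_left _ _ hdet, neg_mulVec,
        add_neg_cancel]
  have hupper : A *ᵥ x + B *ᵥ (-(D⁻¹ * C) *ᵥ x) = (A - B * D⁻¹ * C) *ᵥ x := by
    rw [mulVec_mulVec, Matrix.mul_neg, neg_mulVec, ← sub_eq_add_neg, sub_mulVec, Matrix.mul_assoc]
  simp only [LinearMap.mem_ker, mulVecLin_apply, Submodule.mem_map, fromBlocks_mulVec,
    fromRows_mulVec, one_mulVec, Sum.elim_comp_inl, Sum.elim_comp_inr, hzero, hlower,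
    Sum.elim_eq_iff]
  constructor
  · rintro ⟨h, rfl⟩
    exact ⟨x, hupper ▸ h, rfl, rfl⟩
  · rintro ⟨x, h, rfl, rfl⟩
    exact ⟨hupper.trans h, rfl⟩

/-- Guttman rank additivity: the rank of a block matrix with invertible lower right block is the
size of that block plus the rank of its Schur complement. -/
theorem Matrix.rank_fromBlocks_of_isUnit₂₂ (A : Matrix l m 𝕜) (B : Matrix l n 𝕜)
    (C : Matrix n m 𝕜) (D : Matrix n n 𝕜) (hD : IsUnit D) :
    (fromBlocks A B C D).rank = (A - B * D⁻¹ * C).rank + Fintype.card n := by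
  classical
  have hinj : Function.Injective (fromRows (1 : Matrix m m 𝕜) (-(D⁻¹ * C))).mulVecLin := by
    intro x y h
    simp only [mulVecLin_apply, fromRows_mulVec, one_mulVec, Sum.elim_eq_iff] at h
    exact h.1
  have hker : Module.finrank 𝕜 (LinearMap.ker (fromBlocks A B C D).mulVecLin) =
      Module.finrank 𝕜 (LinearMap.ker (A - B * D⁻¹ * C).mulVecLin) := by
    rw [ker_mulVecLin_fromBlocks_eq_map A B C D hD]
    exact (Submodule.equivMapOfInjective _ hinj _).finrank_eq.symm
  have hblock := (fromBlocks A B C D).mulVecLin.finrank_range_add_finrank_ker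
  have hschur := (A - B * D⁻¹ * C).mulVecLin.finrank_range_add_finrank_ker
  rw [Module.finrank_fintype_fun_eq_card] at hblock hschur
  rw [Fintype.card_sum] at hblock
  unfold rank
  omega

end SchurComplement

/-- Theorem 1 (invariance of deflation): two deflated pencils of the same DAE,
related by a column permutation, have matrices of equal ranks. -/
theorem deflation_rank_invariance (r m : ℕ)
    (S S' K K' : Matrix (Fin r) (Fin r) ℝ)
    (T T' L L' : Matrix (Fin r) (Fin m) ℝ)
    (M M' : Matrix (Fin m) (Fin r) ℝ)
    (N N' : Matrix (Fin m) (Fin m) ℝ)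
    (hN : IsUnit N) (hN' : IsUnit N')
    (P₀ : Matrix (Fin r ⊕ Fin m) (Fin r ⊕ Fin m) ℝ)
    (hP₀ : ∃ σ : Equiv.Perm (Fin r ⊕ Fin m), P₀ = σ.permMatrix ℝ)
    (hE : fromBlocks S T M N * P₀ = fromBlocks S' T' M' N')
    (hA : fromBlocks K L M N * P₀ = fromBlocks K' L' M' N') :
    (S - T * N⁻¹ * M).rank = (S' - T' * N'⁻¹ * M').rank ∧
    (K - L * N⁻¹ * M).rank = (K' - L' * N'⁻¹ * M').rank := by
  obtain ⟨σ, rfl⟩ := hP₀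
  have hσ : IsUnit (σ.permMatrix ℝ).det := by
    rw [det_permutation]
    exact (Equiv.Perm.sign σ).isUnit.map (Int.castRingHom ℝ)
  have rank_schur_eq {A A' : Matrix (Fin r) (Fin r) ℝ} {B B' : Matrix (Fin r) (Fin m) ℝ}
      (h : fromBlocks A B M N * σ.permMatrix ℝ = fromBlocks A' B' M' N') :
      (A - B * N⁻¹ * M).rank = (A' - B' * N'⁻¹ * M').rank := by
    have hrank := rank_mul_eq_left_of_isUnit_det _ (fromBlocks A B M N) hσ
    rw [h, rank_fromBlocks_of_isUnit₂₂ _ _ _ _ hN,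
      rank_fromBlocks_of_isUnit₂₂ _ _ _ _ hN'] at hrank
    exact (Nat.add_right_cancel hrank).symm
  exact ⟨rank_schur_eq hE, rank_schur_eq hA⟩
end

section
/- Let r, m be natural numbers, A ∈ ℝ^{r×r}, B ∈ ℝ^{r×m}, C ∈ ℝ^{m×r}, and let k ≥ 1 be a natural number. Then (fromBlocks A B (C*A) (C*B))^k = fromBlocks ((A + B*C)^(k−1) * A) ((A + B*C)^(k−1) * B) (C * (A + B*C)^(k−1) * A) (C * (A + B*C)^(k−1) * B). -/
open Matrix

/-- Lemma 4: powers of the block matrix `[[A, B], [C*A, C*B]]`. -/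
theorem block_matrix_pow (r m : ℕ)
    (A : Matrix (Fin r) (Fin r) ℝ) (B : Matrix (Fin r) (Fin m) ℝ)
    (C : Matrix (Fin m) (Fin r) ℝ) (k : ℕ) (hk : 1 ≤ k) :
    (fromBlocks A B (C * A) (C * B)) ^ k =
      fromBlocks ((A + B * C) ^ (k - 1) * A) ((A + B * C) ^ (k - 1) * B)
        (C * (A + B * C) ^ (k - 1) * A) (C * (A + B * C) ^ (k - 1) * B) := by
  induction k, hk using Nat.le_induction with
  | base => simp
  | succ n hn ih =>
    obtain ⟨n, rfl⟩ := Nat.exists_eq_add_of_le' hn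
    rw [pow_succ, ih, fromBlocks_multiply]
    simp only [Nat.add_sub_cancel, pow_succ, Matrix.mul_add, Matrix.add_mul, Matrix.mul_assoc]
end

section
/- Let r, m be natural numbers, λ ∈ ℝ, S, K ∈ ℝ^{r×r}, T, L ∈ ℝ^{r×m}, M ∈ ℝ^{m×r}, N ∈ ℝ^{m×m} invertible, and suppose C := fromBlocks (λ•S + K) (λ•T + L) M N is invertible. Set E₁ = S − T*N⁻¹*M, A₁ = K − L*N⁻¹*M and C₁ = λ•E₁ + A₁ (which is invertible). Then C⁻¹ * (fromBlocks S T 0 0) = fromBlocks (C₁⁻¹*S) (C₁⁻¹*T) (−N⁻¹*M*C₁⁻¹*S) (−N⁻¹*M*C₁⁻¹*T). -/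
open Matrix

/-- Applying the inverse of a block matrix with invertible lower right block `D` to a block row,
in terms of the inverse of the Schur complement of `D`. -/
theorem inv_fromBlocks_mul_fromBlocks_zero {n p α : Type*} [Fintype n] [DecidableEq n] [Fintype p]
    [DecidableEq p] [CommRing α] (A : Matrix n n α) (B : Matrix n p α) (C : Matrix p n α)
    (D : Matrix p p α) (S : Matrix n n α) (T : Matrix n p α) (hD : IsUnit D)
    (h : IsUnit (fromBlocks A B C D)) :
    (fromBlocks A B C D)⁻¹ * fromBlocks S T 0 0 =
      fromBlocks ((A - B * D⁻¹ * C)⁻¹ * S) ((A - B * D⁻¹ * C)⁻¹ * T)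
        (-(D⁻¹ * C * (A - B * D⁻¹ * C)⁻¹ * S)) (-(D⁻¹ * C * (A - B * D⁻¹ * C)⁻¹ * T)) := by
  let := hD.invertible
  let := h.invertible
  let := invertibleOfFromBlocks₂₂Invertible A B C D
  rw [← invOf_eq_nonsing_inv (fromBlocks A B C D), invOf_fromBlocks₂₂_eq, fromBlocks_multiply]
  simp [← invOf_eq_nonsing_inv]

/-- Lemma 3 part 1: expression of `C⁻¹ * [[S, T], [0, 0]]` in terms of the
deflated pencil `C₁ = λ • E₁ + A₁`. -/
theorem deflation_inverse_identity (r m : ℕ) (l : ℝ)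
    (S K : Matrix (Fin r) (Fin r) ℝ) (T L : Matrix (Fin r) (Fin m) ℝ)
    (M : Matrix (Fin m) (Fin r) ℝ) (N : Matrix (Fin m) (Fin m) ℝ)
    (hN : IsUnit N)
    (hC : IsUnit (fromBlocks (l • S + K) (l • T + L) M N)) :
    (fromBlocks (l • S + K) (l • T + L) M N)⁻¹ * fromBlocks S T 0 0 =
      fromBlocks
        ((l • (S - T * N⁻¹ * M) + (K - L * N⁻¹ * M))⁻¹ * S)
        ((l • (S - T * N⁻¹ * M) + (K - L * N⁻¹ * M))⁻¹ * T)
        (-(N⁻¹ * M * (l • (S - T * N⁻¹ * M) + (K - L * N⁻¹ * M))⁻¹ * S))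
        (-(N⁻¹ * M * (l • (S - T * N⁻¹ * M) + (K - L * N⁻¹ * M))⁻¹ * T)) := by
  have hE : l • (S - T * N⁻¹ * M) + (K - L * N⁻¹ * M) =
      l • S + K - (l • T + L) * N⁻¹ * M := by
    simp only [smul_sub, Matrix.add_mul, Matrix.smul_mul]
    abel
  rw [hE]
  exact inv_fromBlocks_mul_fromBlocks_zero _ _ _ _ _ _ hN hC
end

section
/- Let r, m be natural numbers, λ ∈ ℝ, S, K ∈ ℝ^{r×r}, T, L ∈ ℝ^{r×m}, M ∈ ℝ^{m×r}, N ∈ ℝ^{m×m} invertible, and suppose C := fromBlocks (λ•S + K) (λ•T + L) M N is invertible. Set E₁ = S − T*N⁻¹*M, A₁ = K − L*N⁻¹*M and C₁ = λ•E₁ + A₁ (which is invertible). Then for every natural number k ≥ 1, (C⁻¹ * (fromBlocks S T 0 0))^k = fromBlocks ((C₁⁻¹*E₁)^(k−1)*C₁⁻¹*S) ((C₁⁻¹*E₁)^(k−1)*C₁⁻¹*T) (−N⁻¹*M*(C₁⁻¹*E₁)^(k−1)*C₁⁻¹*S) (−N⁻¹*M*(C₁⁻¹*E₁)^(k−1)*C₁⁻¹*T).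 -/
open Matrix

namespace Matrix

variable {m n α : Type*} [Fintype m] [Fintype n] [DecidableEq m] [DecidableEq n] [CommRing α]

/-- If the lower right block is invertible, the Schur complement of an invertible block matrix is
invertible. -/
theorem isUnit_schurComplement_of_isUnit_fromBlocks {A : Matrix m m α} {B : Matrix m n α}
    {M : Matrix n m α} {N : Matrix n n α} (hN : IsUnit N) (h : IsUnit (fromBlocks A B M N)) :
    IsUnit (A - B * N⁻¹ * M) := by
  let _ := hN.invertible
  simpa only [invOf_eq_nonsing_inv] using isUnit_fromBlocks_iff_of_invertible₂₂.mp h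

/-- The inverse of a block matrix applied to a matrix supported on the upper blocks, in terms of
the Schur complement. -/
theorem inv_fromBlocks_mul_fromBlocks_zero {A : Matrix m m α} {B : Matrix m n α}
    {M : Matrix n m α} {N : Matrix n n α} (hN : IsUnit N) (h : IsUnit (fromBlocks A B M N))
    (S : Matrix m m α) (T : Matrix m n α) :
    (fromBlocks A B M N)⁻¹ * fromBlocks S T 0 0 =
      fromBlocks ((A - B * N⁻¹ * M)⁻¹ * S) ((A - B * N⁻¹ * M)⁻¹ * T)
        (-(N⁻¹ * M * ((A - B * N⁻¹ * M)⁻¹ * S))) (-(N⁻¹ * M * ((A - B * N⁻¹ * M)⁻¹ * T))) := by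
  have hdetN := (isUnit_iff_isUnit_det N).mp hN
  have hdetC := (isUnit_iff_isUnit_det _).mp (isUnit_schurComplement_of_isUnit_fromBlocks hN h)
  have hmul (Y : Matrix m m α) (Z : Matrix m n α) :
      fromBlocks A B M N * fromBlocks Y Z (-(N⁻¹ * M * Y)) (-(N⁻¹ * M * Z)) =
        fromBlocks ((A - B * N⁻¹ * M) * Y) ((A - B * N⁻¹ * M) * Z) 0 0 := by
    simp only [fromBlocks_multiply, Matrix.mul_neg, Matrix.neg_mul, Matrix.add_mul,
      Matrix.mul_assoc, mul_nonsing_inv_cancel_left _ _ hdetN, add_neg_cancel, sub_eq_add_neg]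
  have := h.invertible
  rw [inv_mul_eq_iff_eq_mul_of_invertible, hmul, mul_nonsing_inv_cancel_left _ _ hdetC,
    mul_nonsing_inv_cancel_left _ _ hdetC]

/-- Powers of a block matrix whose block rows are `P * [S, T]` and `-(Q * P * [S, T])`. -/
theorem fromBlocks_mul_neg_mul_pow_succ (P S : Matrix m m α) (T : Matrix m n α)
    (Q : Matrix n m α) (k : ℕ) :
    fromBlocks (P * S) (P * T) (-(Q * (P * S))) (-(Q * (P * T))) ^ (k + 1) =
      fromBlocks ((P * (S - T * Q)) ^ k * P * S) ((P * (S - T * Q)) ^ k * P * T)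
        (-(Q * (P * (S - T * Q)) ^ k * P * S)) (-(Q * (P * (S - T * Q)) ^ k * P * T)) := by
  induction k with
  | zero => simp [Matrix.mul_assoc]
  | succ k ih =>
    rw [pow_succ', ih, fromBlocks_multiply, pow_succ' (P * (S - T * Q))]
    generalize (P * (S - T * Q)) ^ k = X
    simp only [Matrix.mul_neg, Matrix.neg_mul, Matrix.mul_assoc,
      sub_eq_add_neg, neg_add, neg_neg, Matrix.mul_add, Matrix.add_mul]

end Matrix

/-- Lemma 3 part 2: powers of `C⁻¹ * [[S, T], [0, 0]]` in terms of the
deflated pencil `C₁ = λ • E₁ + A₁` and `E₁`. -/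
theorem deflation_inverse_identity_pow (r m : ℕ) (l : ℝ)
    (S K : Matrix (Fin r) (Fin r) ℝ) (T L : Matrix (Fin r) (Fin m) ℝ)
    (M : Matrix (Fin m) (Fin r) ℝ) (N : Matrix (Fin m) (Fin m) ℝ)
    (hN : IsUnit N)
    (hC : IsUnit (fromBlocks (l • S + K) (l • T + L) M N))
    (E₁ A₁ C₁ : Matrix (Fin r) (Fin r) ℝ)
    (hE₁ : E₁ = S - T * N⁻¹ * M) (hA₁ : A₁ = K - L * N⁻¹ * M)
    (hC₁ : C₁ = l • E₁ + A₁)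
    (k : ℕ) (hk : 1 ≤ k) :
    ((fromBlocks (l • S + K) (l • T + L) M N)⁻¹ * fromBlocks S T 0 0) ^ k =
      fromBlocks
        ((C₁⁻¹ * E₁) ^ (k - 1) * C₁⁻¹ * S)
        ((C₁⁻¹ * E₁) ^ (k - 1) * C₁⁻¹ * T)
        (-(N⁻¹ * M * (C₁⁻¹ * E₁) ^ (k - 1) * C₁⁻¹ * S))
        (-(N⁻¹ * M * (C₁⁻¹ * E₁) ^ (k - 1) * C₁⁻¹ * T)) := by
  have hschur : (l • S + K) - (l • T + L) * N⁻¹ * M = C₁ := by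
    rw [hC₁, hE₁, hA₁]
    simp only [Matrix.add_mul, Matrix.smul_mul, smul_sub]
    abel
  obtain ⟨j, rfl⟩ := Nat.exists_eq_add_of_le' hk
  rw [inv_fromBlocks_mul_fromBlocks_zero hN hC, hschur, fromBlocks_mul_neg_mul_pow_succ,
    Nat.add_sub_cancel, hE₁, Matrix.mul_assoc T]
end

section
/- Let r, m be natural numbers, λ ∈ ℝ, S, K ∈ ℝ^{r×r}, T, L ∈ ℝ^{r×m}, M ∈ ℝ^{m×r}, N ∈ ℝ^{m×m} invertible, and suppose C := fromBlocks (λ•S + K) (λ•T + L) M N is invertible. Set E₁ = S − T*N⁻¹*M, A₁ = K − L*N⁻¹*M and C₁ = λ•E₁ + A₁ (which is invertible). For every natural number k ≥ 1 and every x ∈ ℝ^r with (C₁⁻¹*E₁)^(k−1) applied to x equal to 0, the vector (x, −N⁻¹*M x) ∈ ℝ^r × ℝ^m lies in the kernel of the linear map associated with (C⁻¹ * (fromBlocks S T 0 0))^k. -/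
open Matrix

/-- A rectangular intertwining relation `A * P = P * B` passes to powers. -/
theorem Matrix.pow_mul_of_mul_eq_mul {m n R : Type*} [Fintype m] [DecidableEq m] [Fintype n]
    [DecidableEq n] [Semiring R] {A : Matrix m m R} {B : Matrix n n R} {P : Matrix m n R}
    (h : A * P = P * B) (k : ℕ) : A ^ k * P = P * B ^ k := by
  induction k with
  | zero => simp
  | succ k ih => rw [pow_succ, Matrix.mul_assoc, h, ← Matrix.mul_assoc, ih, Matrix.mul_assoc,
      ← pow_succ]

/-- The column block `[1; -N⁻¹ M]`, lifting a vector `x` to `(x, -N⁻¹ M x)`. -/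
noncomputable abbrev Matrix.schurLift {m n R : Type*} [DecidableEq n] [Fintype m] [DecidableEq m]
    [CommRing R] (N : Matrix m m R) (M : Matrix m n R) : Matrix (n ⊕ m) n R :=
  fromRows 1 (-(N⁻¹ * M))

/-- Multiplying a block matrix by the column block `[1; -N⁻¹ M]`. -/
theorem Matrix.fromBlocks_mul_schurLift {l m n o R : Type*} [Fintype n] [DecidableEq n]
    [Fintype m] [DecidableEq m] [CommRing R] (A : Matrix l n R) (B : Matrix l m R)
    (C : Matrix o n R) (D : Matrix o m R) (N : Matrix m m R) (M : Matrix m n R) :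
    fromBlocks A B C D * schurLift N M =
      fromRows (A - B * N⁻¹ * M) (C - D * N⁻¹ * M) := by
  rw [schurLift, fromBlocks_mul_fromRows]
  simp [sub_eq_add_neg, Matrix.mul_assoc]

/-- Kernel transfer in the deflation: if `(C₁⁻¹ * E₁)^(k-1) x = 0` then
`(x, -N⁻¹ M x)` lies in the kernel of `(C⁻¹ * [[S, T], [0, 0]])^k`. -/
theorem deflation_kernel_transfer (r m : ℕ) (l : ℝ)
    (S K : Matrix (Fin r) (Fin r) ℝ) (T L : Matrix (Fin r) (Fin m) ℝ)
    (M : Matrix (Fin m) (Fin r) ℝ) (N : Matrix (Fin m) (Fin m) ℝ)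
    (hN : IsUnit N)
    (hC : IsUnit (fromBlocks (l • S + K) (l • T + L) M N))
    (E₁ A₁ C₁ : Matrix (Fin r) (Fin r) ℝ)
    (hE₁ : E₁ = S - T * N⁻¹ * M) (hA₁ : A₁ = K - L * N⁻¹ * M)
    (hC₁ : C₁ = l • E₁ + A₁)
    (k : ℕ) (hk : 1 ≤ k)
    (x : Fin r → ℝ) (hx : ((C₁⁻¹ * E₁) ^ (k - 1)).mulVec x = 0) :
    Sum.elim x (-(N⁻¹ * M).mulVec x) ∈
      LinearMap.ker
        (((fromBlocks (l • S + K) (l • T + L) M N)⁻¹ * fromBlocks S T 0 0) ^ k).mulVecLin := by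
  have hNdet : IsUnit N.det := (isUnit_iff_isUnit_det N).mp hN
  have hschur : l • S + K - (l • T + L) * N⁻¹ * M = C₁ := by
    rw [hC₁, hE₁, hA₁, Matrix.add_mul, Matrix.add_mul, Matrix.smul_mul, Matrix.smul_mul, smul_sub]
    abel
  have hC₁unit : IsUnit C₁ := by
    let := N.invertibleOfIsUnitDet hNdet
    have h := isUnit_fromBlocks_iff_of_invertible₂₂.mp hC
    rwa [invOf_eq_nonsing_inv, hschur] at h
  have hCP : fromBlocks (l • S + K) (l • T + L) M N * schurLift N M =
      fromRows C₁ 0 := by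
    rw [fromBlocks_mul_schurLift, hschur, mul_nonsing_inv N hNdet, Matrix.one_mul, sub_self]
  have hEP : fromBlocks S T 0 0 * schurLift N M =
      (fromRows E₁ 0 : Matrix (Fin r ⊕ Fin m) (Fin r) ℝ) := by
    rw [fromBlocks_mul_schurLift, ← hE₁]
    simp
  have hinter : (fromBlocks (l • S + K) (l • T + L) M N)⁻¹ * fromBlocks S T 0 0 *
      schurLift N M = schurLift N M * (C₁⁻¹ * E₁) := by
    have hfactor : (fromRows E₁ 0 : Matrix (Fin r ⊕ Fin m) (Fin r) ℝ) =
        fromRows C₁ 0 * (C₁⁻¹ * E₁) := by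
      rw [fromRows_mul, mul_nonsing_inv_cancel_left _ _ ((isUnit_iff_isUnit_det C₁).mp hC₁unit),
        Matrix.zero_mul]
    rw [Matrix.mul_assoc, hEP, hfactor, ← hCP, Matrix.mul_assoc,
      nonsing_inv_mul_cancel_left _ _ ((isUnit_iff_isUnit_det _).mp hC)]
  have hvec : Sum.elim x (-(N⁻¹ * M).mulVec x) = (schurLift N M).mulVec x := by
    rw [schurLift, fromRows_mulVec, one_mulVec, neg_mulVec]
  obtain ⟨j, rfl⟩ := Nat.exists_eq_add_of_le hk
  rw [Nat.add_sub_cancel_left] at hx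
  rw [LinearMap.mem_ker, mulVecLin_apply, hvec, mulVec_mulVec, pow_mul_of_mul_eq_mul hinter,
    pow_add, pow_one, ← mulVec_mulVec, ← mulVec_mulVec, hx, mulVec_zero, mulVec_zero]
end

section
/- Let n be a natural number, E, A ∈ ℝ^{n×n}, and λ ∈ ℝ such that C := λ•E + A is invertible; assume E is not invertible, and write B = C⁻¹ * E. Then ker of the linear map of B² equals ker of the linear map of B (i.e., the Kronecker index of the pencil (E, A) equals one) if and only if the following holds: for every x ∈ ℝ^n, if E·x = 0 and A·x lies in the range of E (i.e., ∃ y, A·x = E·y), then x = 0. -/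
open Matrix

/-- Lemma 5: the Kronecker index of a regular pencil `(E, A)` equals one iff
every `x` with `E x = 0` and `A x ∈ range E` vanishes. -/
theorem kronecker_index_one_iff (n : ℕ) (E A : Matrix (Fin n) (Fin n) ℝ)
    (l : ℝ) (hC : IsUnit (l • E + A)) (hE : ¬ IsUnit E)
    (B : Matrix (Fin n) (Fin n) ℝ) (hB : B = (l • E + A)⁻¹ * E) :
    LinearMap.ker (B ^ 2).mulVecLin = LinearMap.ker B.mulVecLin ↔
      ∀ x : Fin n → ℝ, E.mulVec x = 0 → (∃ y, A.mulVec x = E.mulVec y) → x = 0 := by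
  set C := l • E + A with hCdef
  have hCB : ∀ z, C.mulVec (B.mulVec z) = E.mulVec z := fun z => by
    rw [Matrix.mulVec_mulVec, hB,
      Matrix.mul_nonsing_inv_cancel_left _ _ ((Matrix.isUnit_iff_isUnit_det C).mp hC)]
  have hinj : Function.Injective C.mulVec := Matrix.mulVec_injective_of_isUnit hC
  have hCker : ∀ x, E.mulVec x = 0 → C.mulVec x = A.mulVec x := fun x hx => by
    rw [hCdef, Matrix.add_mulVec, Matrix.smul_mulVec, hx, smul_zero, zero_add]
  have hsq : ∀ y, (B ^ 2).mulVec y = B.mulVec (B.mulVec y) := fun y => by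
    rw [Matrix.mulVec_mulVec, sq]
  constructor
  · rintro h x hx ⟨y, hy⟩
    have hxy : x = B.mulVec y := hinj <| by rw [hCB, hCker x hx, hy]
    have hBx : B.mulVec x = 0 := hinj <| by rw [hCB, hx, Matrix.mulVec_zero]
    have hmem : y ∈ LinearMap.ker (B ^ 2).mulVecLin := by
      rw [LinearMap.mem_ker, Matrix.mulVecLin_apply, hsq, ← hxy, hBx]
    rw [h, LinearMap.mem_ker, Matrix.mulVecLin_apply] at hmem
    rw [hxy, hmem]
  · intro h
    ext y
    simp only [LinearMap.mem_ker, Matrix.mulVecLin_apply, hsq]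
    refine ⟨fun hy => ?_, fun hy => by rw [hy, Matrix.mulVec_zero]⟩
    have hEx : E.mulVec (B.mulVec y) = 0 := by rw [← hCB, hy, Matrix.mulVec_zero]
    exact h _ hEx ⟨y, by rw [← hCker _ hEx, hCB]⟩
end

section
/- Let r, m be natural numbers with m ≥ 1 and n = r + m (identify Fin n with Fin r ⊕ Fin m). Let E, A ∈ ℝ^{n×n}, U ∈ ℝ^{n×n} invertible, P an n×n permutation matrix, S, K ∈ ℝ^{r×r}, T, L ∈ ℝ^{r×m}, M ∈ ℝ^{m×r}, N ∈ ℝ^{m×m} invertible, with E = U * (fromBlocks S T 0 0) * P⁻¹, A = U * (fromBlocks K L M N) * P⁻¹, and rank(E) = r. Let λ ∈ ℝ be such that C := λ•E + A is invertible, and set B = C⁻¹ * E and E₁ = S − T*N⁻¹*M. Then ker of the linear map of B² equals ker of the linear map of B (i.e., the Kronecker index of (E, A) equals one) if and only if E₁ is invertible. -/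
open Matrix

lemma Matrix.ker_sq_eq_ker_iff {n : Type*} [Fintype n] [DecidableEq n] (X : Matrix n n ℝ) :
    LinearMap.ker (X ^ 2).mulVecLin = LinearMap.ker X.mulVecLin ↔
      ∀ x, X *ᵥ (X *ᵥ x) = 0 → X *ᵥ x = 0 := by
  constructor
  · intro h x hx
    have : x ∈ LinearMap.ker (X ^ 2).mulVecLin := by
      simpa [pow_two] using hx
    rw [h] at this
    simpa using this
  · intro h
    ext x
    simp only [LinearMap.mem_ker, mulVecLin_apply, pow_two, ← mulVec_mulVec]
    exact ⟨h x, fun hx => by rw [hx, mulVec_zero]⟩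

lemma Matrix.mulVec_eq_zero_iff_of_isUnit {n : Type*} [Fintype n] [DecidableEq n]
    {X : Matrix n n ℝ} (hX : IsUnit X) (x : n → ℝ) : X *ᵥ x = 0 ↔ x = 0 :=
  ⟨fun h => (mulVec_injective_iff_isUnit.mpr hX) (by rw [h, mulVec_zero]),
    fun h => by rw [h, mulVec_zero]⟩

/-- If `V = U * F * Q` and `C = U * D * Q` with `U`, `Q`, `D` invertible, then `C⁻¹ * V` satisfies
`ker X² = ker X` iff `F` is injective on `D⁻¹ (range F)`. -/
lemma Matrix.ker_sq_inv_mul_eq_ker_iff {n : Type*} [Fintype n] [DecidableEq n]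
    {U Q D : Matrix n n ℝ} (F : Matrix n n ℝ) (hU : IsUnit U) (hQ : IsUnit Q) (hD : IsUnit D) :
    LinearMap.ker (((U * D * Q)⁻¹ * (U * F * Q)) ^ 2).mulVecLin =
        LinearMap.ker ((U * D * Q)⁻¹ * (U * F * Q)).mulVecLin ↔
      ∀ x z, D *ᵥ z = F *ᵥ x → F *ᵥ z = 0 → z = 0 := by
  have hU' := (isUnit_iff_isUnit_det U).mp hU
  have hQ' := (isUnit_iff_isUnit_det Q).mp hQ
  have hD' := (isUnit_iff_isUnit_det D).mp hD
  have hX : (U * D * Q)⁻¹ * (U * F * Q) = Q⁻¹ * (D⁻¹ * (F * Q)) := by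
    rw [mul_inv_rev, mul_inv_rev, Matrix.mul_assoc U F Q, Matrix.mul_assoc Q⁻¹,
      Matrix.mul_assoc D⁻¹, nonsing_inv_mul_cancel_left _ _ hU']
  have hQi : IsUnit Q⁻¹ := isUnit_nonsing_inv_iff.mpr hQ
  have hDi : IsUnit D⁻¹ := isUnit_nonsing_inv_iff.mpr hD
  have hcancel (v : n → ℝ) : Q *ᵥ (Q⁻¹ *ᵥ v) = v := by
    rw [mulVec_mulVec, mul_nonsing_inv _ hQ', one_mulVec]
  rw [hX, ker_sq_eq_ker_iff]
  simp only [← mulVec_mulVec, hcancel, mulVec_eq_zero_iff_of_isUnit hQi]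
  constructor
  · intro h x z hz hFz
    have hzx : D⁻¹ *ᵥ (F *ᵥ x) = z := by
      rw [← hz, mulVec_mulVec, nonsing_inv_mul _ hD', one_mulVec]
    have := h (Q⁻¹ *ᵥ x)
    rw [hcancel, hzx, hFz, mulVec_zero] at this
    exact this rfl
  · intro h x hx
    refine h (Q *ᵥ x) _ ?_ ((mulVec_eq_zero_iff_of_isUnit hDi _).mp hx)
    rw [mulVec_mulVec, mul_nonsing_inv _ hD', one_mulVec]

lemma Matrix.exists_fromBlocks_zero_mulVec_eq {m n : Type*} [Fintype m] [Fintype n]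
    [DecidableEq m] [DecidableEq n] {S : Matrix m m ℝ} {T : Matrix m n ℝ}
    (h : (fromBlocks S T 0 0 : Matrix (m ⊕ n) (m ⊕ n) ℝ).rank = Fintype.card m) (y : m → ℝ) :
    ∃ x, (fromBlocks S T 0 0 : Matrix (m ⊕ n) (m ⊕ n) ℝ) *ᵥ x = Sum.elim y 0 := by
  have hF : (fromBlocks S T 0 0 : Matrix (m ⊕ n) (m ⊕ n) ℝ) =
      fromRows (1 : Matrix m m ℝ) (0 : Matrix n m ℝ) * fromCols S T := by
    rw [fromRows_mul_fromCols]
    simp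
  have hle : Fintype.card m ≤ (fromCols S T).rank := by
    rw [← h, hF]
    exact rank_mul_le_right _ _
  have htop : LinearMap.range (fromCols S T).mulVecLin = ⊤ := by
    apply Submodule.eq_top_of_finrank_eq
    rw [Module.finrank_fintype_fun_eq_card]
    exact le_antisymm (rank_le_card_height _) hle
  obtain ⟨x, hx⟩ := LinearMap.range_eq_top.mp htop y
  rw [mulVecLin_apply] at hx
  refine ⟨x, ?_⟩
  rw [hF, ← mulVec_mulVec, hx, fromRows_mulVec, one_mulVec, zero_mulVec]

/-- Lemma 6: the Kronecker index of `(E, A)` equals one iff the deflated matrix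
`E₁ = S - T * N⁻¹ * M` is invertible. -/
theorem kronecker_index_one_iff_deflated_invertible (r m : ℕ) (hm : 1 ≤ m)
    (E A U : Matrix (Fin r ⊕ Fin m) (Fin r ⊕ Fin m) ℝ) (hU : IsUnit U)
    (P : Matrix (Fin r ⊕ Fin m) (Fin r ⊕ Fin m) ℝ)
    (hP : ∃ σ : Equiv.Perm (Fin r ⊕ Fin m), P = σ.permMatrix ℝ)
    (S K : Matrix (Fin r) (Fin r) ℝ) (T L : Matrix (Fin r) (Fin m) ℝ)
    (M : Matrix (Fin m) (Fin r) ℝ) (N : Matrix (Fin m) (Fin m) ℝ)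
    (hN : IsUnit N)
    (hE : E = U * fromBlocks S T 0 0 * P⁻¹)
    (hA : A = U * fromBlocks K L M N * P⁻¹)
    (hrank : E.rank = r)
    (l : ℝ) (hC : IsUnit (l • E + A))
    (B : Matrix (Fin r ⊕ Fin m) (Fin r ⊕ Fin m) ℝ) (hB : B = (l • E + A)⁻¹ * E)
    (E₁ : Matrix (Fin r) (Fin r) ℝ) (hE₁ : E₁ = S - T * N⁻¹ * M) :
    LinearMap.ker (B ^ 2).mulVecLin = LinearMap.ker B.mulVecLin ↔ IsUnit E₁ := by
  obtain ⟨σ, rfl⟩ := hP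
  have hQ : IsUnit (σ.permMatrix ℝ)⁻¹ := by
    rw [isUnit_nonsing_inv_iff, isUnit_iff_isUnit_det, det_permutation]
    exact (Equiv.Perm.sign σ).isUnit.map (Int.castRingHom ℝ)
  generalize (σ.permMatrix ℝ)⁻¹ = Q at hE hA hQ
  set F : Matrix (Fin r ⊕ Fin m) (Fin r ⊕ Fin m) ℝ := fromBlocks S T 0 0 with hF
  have hCD : l • E + A = U * (fromBlocks (l • S + K) (l • T + L) M N) * Q := by
    have : fromBlocks (l • S + K) (l • T + L) M N = l • F + fromBlocks K L M N := by
      simp [hF, fromBlocks_smul, fromBlocks_add]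
    rw [this, hE, hA, Matrix.mul_add, Matrix.add_mul, Matrix.mul_smul, Matrix.smul_mul]
  have hD : IsUnit (fromBlocks (l • S + K) (l • T + L) M N) := by
    rw [hCD, isUnit_iff_isUnit_det, det_mul, det_mul] at hC
    rw [isUnit_iff_isUnit_det]
    exact isUnit_of_mul_isUnit_right (isUnit_of_mul_isUnit_left hC)
  have hrankF : F.rank = Fintype.card (Fin r) := by
    rw [Fintype.card_fin]
    refine Eq.trans ?_ hrank
    rw [hE,
      rank_mul_eq_left_of_isUnit_det _ _ ((isUnit_iff_isUnit_det _).mp hQ),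
      rank_mul_eq_right_of_isUnit_det _ _ ((isUnit_iff_isUnit_det _).mp hU)]
  have hN' := (isUnit_iff_isUnit_det N).mp hN
  rw [hB, hCD, hE, ker_sq_inv_mul_eq_ker_iff F hU hQ hD]
  have hdefl (a : Fin r → ℝ) : S *ᵥ a + T *ᵥ (-(N⁻¹ *ᵥ (M *ᵥ a))) = E₁ *ᵥ a := by
    rw [hE₁, sub_mulVec, mulVec_neg, ← mulVec_mulVec, ← mulVec_mulVec, sub_eq_add_neg]
  have hsol (a : Fin r → ℝ) : M *ᵥ a + N *ᵥ (-(N⁻¹ *ᵥ (M *ᵥ a))) = 0 := by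
    rw [mulVec_neg, mulVec_mulVec, mul_nonsing_inv _ hN', one_mulVec, add_neg_cancel]
  constructor
  · intro h
    rw [← mulVec_injective_iff_isUnit]
    refine (injective_iff_map_eq_zero E₁.mulVecLin).mpr fun a ha => ?_
    rw [mulVecLin_apply] at ha
    obtain ⟨x, hx⟩ := exists_fromBlocks_zero_mulVec_eq hrankF
      ((l • S + K) *ᵥ a + (l • T + L) *ᵥ (-(N⁻¹ *ᵥ (M *ᵥ a))))
    have hz := h x (Sum.elim a (-(N⁻¹ *ᵥ (M *ᵥ a)))) (by
      rw [hF, hx, fromBlocks_mulVec]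
      simp only [Sum.elim_comp_inl, Sum.elim_comp_inr, hsol]) (by
      rw [hF, fromBlocks_mulVec]
      simp only [Sum.elim_comp_inl, Sum.elim_comp_inr, hdefl, ha, zero_mulVec, add_zero,
        Sum.elim_zero_zero])
    funext i
    exact congrFun hz (Sum.inl i)
  · intro h x z hz hFz
    obtain ⟨a, b, rfl⟩ : ∃ a b, z = Sum.elim a b :=
      ⟨z ∘ Sum.inl, z ∘ Sum.inr, (Sum.elim_comp_inl_inr z).symm⟩
    rw [hF, fromBlocks_mulVec, fromBlocks_mulVec] at hz
    rw [hF, fromBlocks_mulVec] at hFz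
    have hMN : M *ᵥ a + N *ᵥ b = 0 := by
      funext i
      simpa using congrFun hz (Sum.inr i)
    have hST : S *ᵥ a + T *ᵥ b = 0 := by
      funext i
      simpa using congrFun hFz (Sum.inl i)
    have hb : b = -(N⁻¹ *ᵥ (M *ᵥ a)) := by
      rw [eq_neg_of_add_eq_zero_left hMN, mulVec_neg, neg_neg, mulVec_mulVec,
        nonsing_inv_mul _ hN', one_mulVec]
    rw [hb, hdefl, mulVec_eq_zero_iff_of_isUnit h] at hST
    rw [hb, hST]
    simp
end

section
/- Let r, m be natural numbers with m ≥ 1 and n = r + m (identify Fin n with Fin r ⊕ Fin m). Let E, A ∈ ℝ^{n×n}, U ∈ ℝ^{n×n} invertible, P an n×n permutation matrix, S, K ∈ ℝ^{r×r}, T, L ∈ ℝ^{r×m}, M ∈ ℝ^{m×r}, N ∈ ℝ^{m×m} invertible, with E = U * (fromBlocks S T 0 0) * P⁻¹, A = U * (fromBlocks K L M N) * P⁻¹, and rank(E) = r. Let λ ∈ ℝ be such that λ•E + A is invertible, and set E₁ = S − T*N⁻¹*M and A₁ = K − L*N⁻¹*M (so λ•E₁ + A₁ is invertible). If E₁ ≠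 0, then the index of (λ•E₁ + A₁)⁻¹ * E₁ is equal to the index of (λ•E + A)⁻¹ * E minus 1. -/
open Matrix

/-- The index of a square real matrix `B`: the smallest `k` such that
`ker (B ^ k) = ker (B ^ (k + 1))`. -/
noncomputable def matIndex {ι : Type*} [Fintype ι] [DecidableEq ι]
    (B : Matrix ι ι ℝ) : ℕ :=
  sInf {k : ℕ | LinearMap.ker (B ^ k).mulVecLin = LinearMap.ker (B ^ (k + 1)).mulVecLin}

theorem ker_mulVecLin_pow_eq_iff_rank_eq {ι : Type*} [Fintype ι] [DecidableEq ι]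
    (B : Matrix ι ι ℝ) (k : ℕ) :
    LinearMap.ker (B ^ k).mulVecLin = LinearMap.ker (B ^ (k + 1)).mulVecLin ↔
      (B ^ k).rank = (B ^ (k + 1)).rank := by
  have hle : LinearMap.ker (B ^ k).mulVecLin ≤ LinearMap.ker (B ^ (k + 1)).mulVecLin := by
    rw [pow_succ', mulVecLin_mul]
    exact LinearMap.ker_le_ker_comp _ _
  have h₁ := (B ^ k).mulVecLin.finrank_range_add_finrank_ker
  have h₂ := (B ^ (k + 1)).mulVecLin.finrank_range_add_finrank_ker
  unfold Matrix.rank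
  constructor
  · intro h
    rw [h] at h₁
    omega
  · intro h
    exact Submodule.eq_of_le_of_finrank_eq hle (by omega)

theorem exists_right_inverse_of_rank_eq_card {ι κ : Type*} [Fintype ι] [DecidableEq ι] [Fintype κ]
    [DecidableEq κ] (F : Matrix κ ι ℝ) (hF : F.rank = Fintype.card κ) :
    ∃ G : Matrix ι κ ℝ, F * G = 1 := by
  refine mulVec_surjective_iff_exists_right_inverse.mp ?_
  change Function.Surjective F.mulVecLin
  rw [← LinearMap.range_eq_top]
  apply Submodule.eq_top_of_finrank_eq
  rw [Module.finrank_fintype_fun_eq_card]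
  exact hF

theorem rank_mul_mul_eq_of_rank_mul_eq_card {ι κ : Type*} [Fintype ι] [DecidableEq ι] [Fintype κ]
    [DecidableEq κ] (H : Matrix ι κ ℝ) (F : Matrix κ ι ℝ) (h : (H * F).rank = Fintype.card κ)
    (X : Matrix κ κ ℝ) : (H * X * F).rank = X.rank := by
  obtain ⟨G, hG⟩ := exists_right_inverse_of_rank_eq_card F
    (le_antisymm F.rank_le_card_height (h ▸ rank_mul_le_right H F))
  obtain ⟨J, hJ⟩ := exists_right_inverse_of_rank_eq_card Hᵀ
    (by
      rw [rank_transpose]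
      exact le_antisymm H.rank_le_card_width (h ▸ rank_mul_le_left H F))
  have hJ' : Jᵀ * H = 1 := by
    rw [← transpose_inj, transpose_mul, transpose_transpose, hJ, transpose_one]
  apply le_antisymm
  · exact (rank_mul_le_left _ _).trans (rank_mul_le_right _ _)
  · calc X.rank = (Jᵀ * (H * X * F * G)).rank := by
          rw [Matrix.mul_assoc (H * X), hG, Matrix.mul_one, ← Matrix.mul_assoc, hJ', Matrix.one_mul]
      _ ≤ (H * X * F).rank := (rank_mul_le_right _ _).trans (rank_mul_le_left _ _)

theorem mul_pow_succ_eq {ι κ : Type*} [Fintype ι] [DecidableEq ι] [Fintype κ] [DecidableEq κ]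
    (H : Matrix ι κ ℝ) (F : Matrix κ ι ℝ) (k : ℕ) :
    (H * F) ^ (k + 1) = H * (F * H) ^ k * F := by
  induction k with
  | zero => simp
  | succ k ih => rw [pow_succ, ih, pow_succ (F * H)]; simp only [Matrix.mul_assoc]

/-- Swapping the factors of a full-rank factorization of a singular matrix lowers the index
by one. -/
theorem matIndex_mul_comm_of_rank_eq_card {ι κ : Type*} [Fintype ι] [DecidableEq ι] [Fintype κ]
    [DecidableEq κ] (H : Matrix ι κ ℝ) (F : Matrix κ ι ℝ) (h : (H * F).rank = Fintype.card κ)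
    (hlt : Fintype.card κ < Fintype.card ι) :
    matIndex (F * H) = matIndex (H * F) - 1 := by
  have hshift (k : ℕ) : ((H * F) ^ (k + 1)).rank = ((F * H) ^ k).rank := by
    rw [mul_pow_succ_eq, rank_mul_mul_eq_of_rank_mul_eq_card H F h]
  simp only [matIndex, ker_mulVecLin_pow_eq_iff_rank_eq]
  have hset : {k | ((F * H) ^ k).rank = ((F * H) ^ (k + 1)).rank} =
      {k | ((H * F) ^ (k + 1)).rank = ((H * F) ^ (k + 1 + 1)).rank} := by
    simp only [hshift]
  rw [hset]
  rcases Set.eq_empty_or_nonempty {k | ((H * F) ^ k).rank = ((H * F) ^ (k + 1)).rank} with he | hne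
  · have he' : {k | ((H * F) ^ (k + 1)).rank = ((H * F) ^ (k + 1 + 1)).rank} = ∅ :=
      by
      refine Set.eq_empty_of_forall_notMem fun k hk => ?_
      exact (Set.eq_empty_iff_forall_notMem.mp he) (k + 1) hk
    rw [he, he', Nat.sInf_empty]
  · have hpos : 1 ≤ sInf {k | ((H * F) ^ k).rank = ((H * F) ^ (k + 1)).rank} := by
      refine le_csInf hne fun k hk => Nat.one_le_iff_ne_zero.mpr ?_
      rintro rfl
      simp only [Set.mem_ofPred_eq, pow_zero, zero_add, pow_one, rank_one, h] at hk
      omega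
    exact Nat.eq_sub_of_add_eq
      (Nat.sInf_add (p := fun k => ((H * F) ^ k).rank = ((H * F) ^ (k + 1)).rank) hpos)

/-- Theorem 7: one step of deflation reduces the Kronecker index by exactly one. -/
theorem deflation_index_reduction (r m : ℕ) (hm : 1 ≤ m)
    (E A U : Matrix (Fin r ⊕ Fin m) (Fin r ⊕ Fin m) ℝ) (hU : IsUnit U)
    (P : Matrix (Fin r ⊕ Fin m) (Fin r ⊕ Fin m) ℝ)
    (hP : ∃ σ : Equiv.Perm (Fin r ⊕ Fin m), P = σ.permMatrix ℝ)
    (S K : Matrix (Fin r) (Fin r) ℝ) (T L : Matrix (Fin r) (Fin m) ℝ)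
    (M : Matrix (Fin m) (Fin r) ℝ) (N : Matrix (Fin m) (Fin m) ℝ)
    (hN : IsUnit N)
    (hE : E = U * fromBlocks S T 0 0 * P⁻¹)
    (hA : A = U * fromBlocks K L M N * P⁻¹)
    (hrank : E.rank = r)
    (l : ℝ) (hC : IsUnit (l • E + A))
    (E₁ A₁ : Matrix (Fin r) (Fin r) ℝ)
    (hE₁ : E₁ = S - T * N⁻¹ * M) (hA₁ : A₁ = K - L * N⁻¹ * M)
    (hE₁ne : E₁ ≠ 0) :
    matIndex ((l • E₁ + A₁)⁻¹ * E₁) = matIndex ((l • E + A)⁻¹ * E) - 1 := by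
  have hPu : IsUnit P.det := by
    obtain ⟨σ, rfl⟩ := hP
    rw [Matrix.det_permutation]
    exact (Equiv.Perm.sign σ).isUnit.map (Int.castRingHom ℝ)
  have hNu : IsUnit N.det := (isUnit_iff_isUnit_det N).mp hN
  have hC_eq : l • E + A = U * fromBlocks (l • S + K) (l • T + L) M N * P⁻¹ := by
    rw [hE, hA, ← smul_mul, ← Matrix.mul_smul, ← Matrix.add_mul, ← Matrix.mul_add, fromBlocks_smul,
      fromBlocks_add]
    simp
  have hC₁_eq : l • E₁ + A₁ = l • S + K - (l • T + L) * N⁻¹ * M := by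
    rw [hE₁, hA₁]
    simp only [smul_sub, Matrix.add_mul, smul_mul]
    abel
  have hC₁ : IsUnit (l • E₁ + A₁).det := by
    have := hN.invertible
    have hdet := (isUnit_iff_isUnit_det _).mp hC
    rw [hC_eq, det_mul, det_mul, det_fromBlocks₂₂, invOf_eq_nonsing_inv, ← hC₁_eq] at hdet
    exact isUnit_of_mul_isUnit_right
      (isUnit_of_mul_isUnit_right (isUnit_of_mul_isUnit_left hdet))
  set H : Matrix (Fin r ⊕ Fin m) (Fin r) ℝ :=
    P * fromRows (1 : Matrix (Fin r) (Fin r) ℝ) (-(N⁻¹ * M)) with hH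
  set F : Matrix (Fin r) (Fin r ⊕ Fin m) ℝ := (l • E₁ + A₁)⁻¹ * (fromCols S T * P⁻¹) with hF
  have hFH : F * H = (l • E₁ + A₁)⁻¹ * E₁ := by
    rw [hF, hH, Matrix.mul_assoc, Matrix.mul_assoc, nonsing_inv_mul_cancel_left _ _ hPu,
      fromCols_mul_fromRows, hE₁]
    simp [Matrix.mul_assoc, sub_eq_add_neg]
  have hCH : (l • E + A) * H = U * fromRows (l • E₁ + A₁) (0 : Matrix (Fin m) (Fin r) ℝ) := by
    rw [hC_eq, hH, Matrix.mul_assoc, nonsing_inv_mul_cancel_left _ _ hPu, Matrix.mul_assoc,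
      fromBlocks_mul_fromRows, hC₁_eq]
    simp [Matrix.mul_assoc, sub_eq_add_neg, mul_nonsing_inv_cancel_left _ _ hNu]
  have hHF : H * F = (l • E + A)⁻¹ * E := by
    have hCHF : (l • E + A) * (H * F) = E := by
      rw [← Matrix.mul_assoc, hCH, hF, hE, Matrix.mul_assoc, Matrix.mul_assoc, fromRows_mul,
        mul_nonsing_inv_cancel_left _ _ hC₁, ← fromRows_fromCols_eq_fromBlocks, fromRows_mul]
      simp
    calc H * F = (l • E + A)⁻¹ * ((l • E + A) * (H * F)) :=
          (nonsing_inv_mul_cancel_left _ _ ((isUnit_iff_isUnit_det _).mp hC)).symm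
      _ = (l • E + A)⁻¹ * E := by rw [hCHF]
  rw [← hFH, ← hHF]
  refine matIndex_mul_comm_of_rank_eq_card H F ?_ (by simp; omega)
  rw [hHF, rank_mul_eq_right_of_isUnit_det _ _
    ((isUnit_nonsing_inv_det_iff).mpr ((isUnit_iff_isUnit_det _).mp hC)), hrank, Fintype.card_fin]
end

section
/- Let r, m be natural numbers with m ≥ 1 and n = r + m (identify Fin n with Fin r ⊕ Fin m). Let E, A ∈ ℝ^{n×n}, U ∈ ℝ^{n×n} invertible, P an n×n permutation matrix, S, K ∈ ℝ^{r×r}, T, L ∈ ℝ^{r×m}, M ∈ ℝ^{m×r}, N ∈ ℝ^{m×m} invertible, with E = U * (fromBlocks S T 0 0) * P⁻¹, A = U * (fromBlocks K L M N) * P⁻¹, and rank(E) = r. Let λ ∈ ℝ be such that λ•E + A is invertible, and set E₁ = S − T*N⁻¹*M. If the index of (λ•E + A)⁻¹ * E is strictly greater than 1, then rank(E) > rank(E₁). -/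
open Matrix

theorem matIndex_le_one {ι : Type*} [Fintype ι] [DecidableEq ι] {B : Matrix ι ι ℝ}
    (h : ∀ v, B *ᵥ (B *ᵥ v) = 0 → B *ᵥ v = 0) : matIndex B ≤ 1 := by
  refine Nat.sInf_le ?_
  ext v
  simp only [LinearMap.mem_ker, mulVecLin_apply, pow_succ, pow_zero, one_mul, ← mulVec_mulVec]
  exact ⟨fun hv => by rw [hv, mulVec_zero], h v⟩

/-- If `N` and its Schur complement `S - T * N⁻¹ * M` are invertible, then
`fromBlocks S T M N` has trivial kernel. -/
theorem eq_zero_of_schur_isUnit {m n : Type*} [Fintype m] [Fintype n] [DecidableEq m]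
    [DecidableEq n] {R : Type*} [CommRing R] {S : Matrix m m R} {T : Matrix m n R}
    {M : Matrix n m R} {N : Matrix n n R} (hN : IsUnit N) (hS : IsUnit (S - T * N⁻¹ * M))
    {x : m → R} {y : n → R} (h₁ : S *ᵥ x + T *ᵥ y = 0) (h₂ : M *ᵥ x + N *ᵥ y = 0) :
    x = 0 ∧ y = 0 := by
  have hy : N⁻¹ *ᵥ (M *ᵥ x) + y = 0 := by
    have h := congrArg (N⁻¹ *ᵥ ·) h₂
    simpa [mulVec_add, mulVec_mulVec, nonsing_inv_mul N ((isUnit_iff_isUnit_det N).1 hN)] using h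
  have hy' : y = -(N⁻¹ *ᵥ (M *ᵥ x)) := eq_neg_of_add_eq_zero_right hy
  have hx : x = 0 := by
    refine mulVec_injective_of_isUnit hS ?_
    simpa [hy', sub_mulVec, mulVec_neg, sub_eq_add_neg, mulVec_mulVec, Matrix.mul_assoc, neg_mulVec, add_mulVec] using h₁
  exact ⟨hx, by simpa [hx] using hy'⟩

/-- Lemma 7, part 1: if the Kronecker index of `(E, A)` exceeds one, the rank of
the deflated matrix `E₁` is strictly smaller than the rank of `E`. -/
theorem deflation_rank_decrease (r m : ℕ) (hm : 1 ≤ m)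
    (E A U : Matrix (Fin r ⊕ Fin m) (Fin r ⊕ Fin m) ℝ) (hU : IsUnit U)
    (P : Matrix (Fin r ⊕ Fin m) (Fin r ⊕ Fin m) ℝ)
    (hP : ∃ σ : Equiv.Perm (Fin r ⊕ Fin m), P = σ.permMatrix ℝ)
    (S K : Matrix (Fin r) (Fin r) ℝ) (T L : Matrix (Fin r) (Fin m) ℝ)
    (M : Matrix (Fin m) (Fin r) ℝ) (N : Matrix (Fin m) (Fin m) ℝ)
    (hN : IsUnit N)
    (hE : E = U * fromBlocks S T 0 0 * P⁻¹)
    (hA : A = U * fromBlocks K L M N * P⁻¹)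
    (hrank : E.rank = r)
    (l : ℝ) (hC : IsUnit (l • E + A))
    (E₁ : Matrix (Fin r) (Fin r) ℝ) (hE₁ : E₁ = S - T * N⁻¹ * M)
    (hind : 1 < matIndex ((l • E + A)⁻¹ * E)) :
    E₁.rank < E.rank := by
  subst hE₁
  by_contra hlt
  have hE₁ : IsUnit (S - T * N⁻¹ * M) := by
    rw [← mulVec_surjective_iff_isUnit]
    refine (LinearMap.range_eq_top (f := (S - T * N⁻¹ * M).mulVecLin)).1
      (Submodule.eq_top_of_finrank_eq (le_antisymm (Submodule.finrank_le _) ?_))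
    exact (Module.finrank_fin_fun ℝ).trans_le (hrank.symm.trans_le (not_lt.1 hlt))
  refine hind.not_ge (matIndex_le_one fun v hv => ?_)
  obtain ⟨σ, rfl⟩ := hP
  have hPu : IsUnit (σ.permMatrix ℝ)⁻¹ := by
    rw [isUnit_nonsing_inv_iff, isUnit_iff_isUnit_det, det_permutation]
    exact (Int.cast_ne_zero.2 (Units.ne_zero _)).isUnit
  set Q := (σ.permMatrix ℝ)⁻¹
  set C := l • E + A with hCdef
  have hCd := (isUnit_iff_isUnit_det C).1 hC
  have hCQ : C = U * fromBlocks (l • S + K) (l • T + L) M N * Q := by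
    rw [hCdef, hE, hA, ← smul_mul_assoc, ← mul_smul_comm, ← add_mul, ← mul_add, fromBlocks_smul,
      fromBlocks_add]
    simp
  set w := (C⁻¹ * E) *ᵥ v with hw
  have hEw : E *ᵥ w = 0 := by
    refine mulVec_injective_of_isUnit ((isUnit_nonsing_inv_iff).2 hC) ?_
    simpa [mulVec_mulVec] using hv
  have hCw : C *ᵥ w = E *ᵥ v := by
    rw [hw, mulVec_mulVec, mul_nonsing_inv_cancel_left _ _ hCd]
  have hUinj := mulVec_injective_of_isUnit hU
  have h₁ : fromBlocks S T (0 : Matrix (Fin m) (Fin r) ℝ) 0 *ᵥ (Q *ᵥ w) = 0 := by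
    apply hUinj
    simpa [hE, ← mulVec_mulVec] using hEw
  have h₂ : fromBlocks (l • S + K) (l • T + L) M N *ᵥ (Q *ᵥ w)
      = fromBlocks S T 0 0 *ᵥ (Q *ᵥ v) := by
    apply hUinj
    rw [hCQ, hE] at hCw
    simpa only [← mulVec_mulVec] using hCw
  rw [fromBlocks_mulVec] at h₁
  rw [fromBlocks_mulVec, fromBlocks_mulVec] at h₂
  obtain ⟨hx, hy⟩ := eq_zero_of_schur_isUnit hN hE₁
    (x := (Q *ᵥ w) ∘ Sum.inl) (y := (Q *ᵥ w) ∘ Sum.inr)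
    (by simpa using congrArg (· ∘ Sum.inl) h₁)
    (by simpa using congrArg (· ∘ Sum.inr) h₂)
  refine mulVec_injective_of_isUnit hPu ?_
  rw [mulVec_zero]
  ext (i | i)
  exacts [congrFun hx i, congrFun hy i]
end

section
/- Let r, m be natural numbers with m ≥ 1 and n = r + m (identify Fin n with Fin r ⊕ Fin m). Let E, A ∈ ℝ^{n×n}, U ∈ ℝ^{n×n} invertible, P an n×n permutation matrix, S, K ∈ ℝ^{r×r}, T, L ∈ ℝ^{r×m}, M ∈ ℝ^{m×r}, N ∈ ℝ^{m×m} invertible, with E = U * (fromBlocks S T 0 0) * P⁻¹, A = U * (fromBlocks K L M N) * P⁻¹, and rank(E) = r. Let λ ∈ ℝ be such that λ•E + A is invertible, and set E₁ = S − T*N⁻¹*M. If the index of (λ•E + A)⁻¹ * E equals 1, then rank(E₁) = rank(E) = r. -/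
open Matrix

/-- If `B` has index one, then `B` and `B ^ 2` have the same kernel. -/
theorem mulVec_eq_zero_of_matIndex_eq_one {ι : Type*} [Fintype ι] [DecidableEq ι]
    {B : Matrix ι ι ℝ} (h : matIndex B = 1) {v : ι → ℝ} (hv : B *ᵥ (B *ᵥ v) = 0) :
    B *ᵥ v = 0 := by
  have hmem := Nat.sInf_mem (Nat.nonempty_of_sInf_eq_succ h)
  change matIndex B ∈ _ at hmem
  rw [h] at hmem
  have hker : LinearMap.ker (B ^ 1).mulVecLin = LinearMap.ker (B ^ (1 + 1)).mulVecLin := hmem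
  have hv' : v ∈ LinearMap.ker (B ^ (1 + 1)).mulVecLin := by
    simpa [pow_two, ← mulVec_mulVec] using hv
  rw [← hker] at hv'
  simpa using hv'

theorem mulVec_surjective_of_card_le_rank {m n : Type*} [Fintype m] [Fintype n]
    {R : Matrix m n ℝ} (h : Fintype.card m ≤ R.rank) : Function.Surjective R.mulVec := by
  have htop : LinearMap.range R.mulVecLin = ⊤ := by
    apply Submodule.eq_top_of_finrank_eq
    rw [Module.finrank_fintype_fun_eq_card]
    exact le_antisymm R.rank_le_card_height h
  exact LinearMap.range_eq_top.mp htop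

theorem rank_fromBlocks_zero_zero_le {m n p q : Type*} [Fintype m] [Fintype n] [Fintype p]
    [Fintype q] [DecidableEq m] (S : Matrix m p ℝ) (T : Matrix m q ℝ) :
    (fromBlocks S T (0 : Matrix n p ℝ) 0).rank ≤ (fromCols S T).rank := by
  have h : fromBlocks S T (0 : Matrix n p ℝ) 0
      = fromRows (1 : Matrix m m ℝ) (0 : Matrix n m ℝ) * fromCols S T := by
    simp
  rw [h]
  exact rank_mul_le_right _ _

/-- Lemma 7, part 2: if the Kronecker index of `(E, A)` equals one, the rank of
the deflated matrix `E₁` equals the rank of `E`, namely `r`. -/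
theorem deflation_rank_equal_of_index_one (r m : ℕ) (hm : 1 ≤ m)
    (E A U : Matrix (Fin r ⊕ Fin m) (Fin r ⊕ Fin m) ℝ) (hU : IsUnit U)
    (P : Matrix (Fin r ⊕ Fin m) (Fin r ⊕ Fin m) ℝ)
    (hP : ∃ σ : Equiv.Perm (Fin r ⊕ Fin m), P = σ.permMatrix ℝ)
    (S K : Matrix (Fin r) (Fin r) ℝ) (T L : Matrix (Fin r) (Fin m) ℝ)
    (M : Matrix (Fin m) (Fin r) ℝ) (N : Matrix (Fin m) (Fin m) ℝ)
    (hN : IsUnit N)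
    (hE : E = U * fromBlocks S T 0 0 * P⁻¹)
    (hA : A = U * fromBlocks K L M N * P⁻¹)
    (hrank : E.rank = r)
    (l : ℝ) (hC : IsUnit (l • E + A))
    (E₁ : Matrix (Fin r) (Fin r) ℝ) (hE₁ : E₁ = S - T * N⁻¹ * M)
    (hind : matIndex ((l • E + A)⁻¹ * E) = 1) :
    E₁.rank = E.rank ∧ E.rank = r := by
  refine ⟨?_, hrank⟩
  have hPu : IsUnit P := by
    obtain ⟨σ, rfl⟩ := hP
    rw [isUnit_iff_isUnit_det, det_permutation]
    exact (Equiv.Perm.sign σ).isUnit.map (Int.castRingHom ℝ)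
  have hPd := (isUnit_iff_isUnit_det P).mp hPu
  have hNd := (isUnit_iff_isUnit_det N).mp hN
  have hCd := (isUnit_iff_isUnit_det _).mp hC
  have hsurj : Function.Surjective (fromCols S T).mulVec := by
    apply mulVec_surjective_of_card_le_rank
    refine ((Fintype.card_fin r).trans hrank.symm).trans_le ?_
    rw [hE]
    exact (rank_mul_le_left _ _).trans <| (rank_mul_le_right _ _).trans <|
      rank_fromBlocks_zero_zero_le S T
  have hEP (w : Fin r ⊕ Fin m → ℝ) :
      E *ᵥ (P *ᵥ w) = U *ᵥ (fromBlocks S T 0 0 *ᵥ w) := by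
    rw [hE, mulVec_mulVec, nonsing_inv_mul_cancel_right _ _ hPd, mulVec_mulVec]
  have hAP (w : Fin r ⊕ Fin m → ℝ) :
      A *ᵥ (P *ᵥ w) = U *ᵥ (fromBlocks K L M N *ᵥ w) := by
    rw [hA, mulVec_mulVec, nonsing_inv_mul_cancel_right _ _ hPd, mulVec_mulVec]
  have hinj : Function.Injective E₁.mulVec := by
    refine (injective_iff_map_eq_zero E₁.mulVecLin).mpr fun v hv => ?_
    replace hv : E₁ *ᵥ v = 0 := hv
    rw [hE₁] at hv
    set w : Fin r ⊕ Fin m → ℝ := Sum.elim v (-(N⁻¹ *ᵥ (M *ᵥ v)))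
    have hEw : fromBlocks S T (0 : Matrix (Fin m) (Fin r) ℝ) 0 *ᵥ w = 0 := by
      have htop : S *ᵥ v + T *ᵥ (-(N⁻¹ *ᵥ (M *ᵥ v))) = 0 := by
        rw [← hv, sub_mulVec, mulVec_neg, mulVec_mulVec, mulVec_mulVec, Matrix.mul_assoc,
          sub_eq_add_neg]
      rw [fromBlocks_mulVec, Sum.elim_comp_inl, Sum.elim_comp_inr, htop]
      simp
    have hMN : M *ᵥ v + N *ᵥ (-(N⁻¹ *ᵥ (M *ᵥ v))) = 0 := by
      rw [mulVec_neg, mulVec_mulVec _ N, mul_nonsing_inv _ hNd, one_mulVec, add_neg_cancel]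
    obtain ⟨z, hz⟩ := hsurj (fromCols K L *ᵥ w)
    have hAw : fromBlocks K L M N *ᵥ w = fromBlocks S T 0 0 *ᵥ z := by
      have hz' : S *ᵥ (z ∘ Sum.inl) + T *ᵥ (z ∘ Sum.inr) =
          K *ᵥ (w ∘ Sum.inl) + L *ᵥ (w ∘ Sum.inr) := by
        simpa only [fromCols_mulVec] using hz
      rw [fromBlocks_mulVec, fromBlocks_mulVec, hz', Sum.elim_comp_inl, Sum.elim_comp_inr, hMN]
      simp
    have hx : (l • E + A)⁻¹ *ᵥ (E *ᵥ (P *ᵥ z)) = P *ᵥ w := by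
      have hCx : (l • E + A) *ᵥ (P *ᵥ w) = E *ᵥ (P *ᵥ z) := by
        rw [add_mulVec, smul_mulVec, hEP, hEw, hAP, hAw, hEP]
        simp
      rw [← hCx, mulVec_mulVec, nonsing_inv_mul _ hCd, one_mulVec]
    have hBz : ((l • E + A)⁻¹ * E) *ᵥ (P *ᵥ z) = P *ᵥ w := by
      rw [← mulVec_mulVec, hx]
    have hPw : P *ᵥ w = 0 := by
      rw [← hBz]
      apply mulVec_eq_zero_of_matIndex_eq_one hind
      rw [hBz, ← mulVec_mulVec, hEP, hEw, mulVec_zero, mulVec_zero]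
    have hw0 : w = 0 := mulVec_injective_of_isUnit hPu (by simpa using hPw)
    funext i
    exact congrFun hw0 (Sum.inl i)
  rw [hrank, rank_of_isUnit _ (mulVec_injective_iff_isUnit.mp hinj), Fintype.card_fin]
end

section
/- Let m be a natural number with m ≥ 1 and n = 1 + m (identify Fin n with Fin 1 ⊕ Fin m). Let E, A ∈ ℝ^{n×n}, U ∈ ℝ^{n×n} invertible, P an n×n permutation matrix, S, K ∈ ℝ^{1×1}, T, L ∈ ℝ^{1×m}, M ∈ ℝ^{m×1}, N ∈ ℝ^{m×m} invertible, with E = U * (fromBlocks S T 0 0) * P⁻¹, A = U * (fromBlocks K L M N) * P⁻¹, and rank(E) = 1. Let λ ∈ ℝ be such that λ•E + A is invertible, and set E₁ = S − T*N⁻¹*M. If the index of (λ•E + A)⁻¹ * E is strictly greater than 1, then E₁ = 0. -/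
open Matrix

/-- If the Schur complement `S - T * N⁻¹ * M` has trivial kernel, then so does
`fromBlocks S T M N`. -/
theorem eq_zero_of_schur_mulVec_injective {m₁ m₂ : Type*} [Fintype m₁] [Fintype m₂]
    [DecidableEq m₂] {S : Matrix m₁ m₁ ℝ} {T : Matrix m₁ m₂ ℝ} {M : Matrix m₂ m₁ ℝ}
    {N : Matrix m₂ m₂ ℝ} (hN : IsUnit N)
    (hinj : ∀ a, (S - T * N⁻¹ * M) *ᵥ a = 0 → a = 0) {a : m₁ → ℝ} {b : m₂ → ℝ}
    (h₁ : S *ᵥ a + T *ᵥ b = 0) (h₂ : M *ᵥ a + N *ᵥ b = 0) : a = 0 ∧ b = 0 := by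
  have hN' : N⁻¹ * N = 1 := nonsing_inv_mul N ((isUnit_iff_isUnit_det N).1 hN)
  have hb : b = -(N⁻¹ *ᵥ (M *ᵥ a)) := by
    rw [eq_neg_of_add_eq_zero_left h₂, mulVec_neg, neg_neg, mulVec_mulVec, hN', one_mulVec]
  have ha : a = 0 := by
    apply hinj
    rw [hb, mulVec_neg, ← sub_eq_add_neg] at h₁
    rw [sub_mulVec, ← mulVec_mulVec, ← mulVec_mulVec, h₁]
  exact ⟨ha, by rw [hb, ha]; simp⟩

/-- Lemma 7, part 3: if `rank E = 1` and the Kronecker index of `(E, A)` exceeds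
one, then the deflated matrix `E₁` is zero. -/
theorem deflation_rank_one_case (m : ℕ) (hm : 1 ≤ m)
    (E A U : Matrix (Fin 1 ⊕ Fin m) (Fin 1 ⊕ Fin m) ℝ) (hU : IsUnit U)
    (P : Matrix (Fin 1 ⊕ Fin m) (Fin 1 ⊕ Fin m) ℝ)
    (hP : ∃ σ : Equiv.Perm (Fin 1 ⊕ Fin m), P = σ.permMatrix ℝ)
    (S K : Matrix (Fin 1) (Fin 1) ℝ) (T L : Matrix (Fin 1) (Fin m) ℝ)
    (M : Matrix (Fin m) (Fin 1) ℝ) (N : Matrix (Fin m) (Fin m) ℝ)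
    (hN : IsUnit N)
    (hE : E = U * fromBlocks S T 0 0 * P⁻¹)
    (hA : A = U * fromBlocks K L M N * P⁻¹)
    (hrank : E.rank = 1)
    (l : ℝ) (hC : IsUnit (l • E + A))
    (E₁ : Matrix (Fin 1) (Fin 1) ℝ) (hE₁ : E₁ = S - T * N⁻¹ * M)
    (hind : 1 < matIndex ((l • E + A)⁻¹ * E)) :
    E₁ = 0 := by
  by_contra hne
  refine absurd (matIndex_le_one fun v hv => ?_) hind.not_ge
  have hinj : ∀ a, (S - T * N⁻¹ * M) *ᵥ a = 0 → a = 0 := by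
    rw [← hE₁]
    intro a ha
    have h00 : E₁ 0 0 ≠ 0 := fun h => hne <| by
      ext i j
      rwa [Subsingleton.elim i 0, Subsingleton.elim j 0]
    have h0 := congrFun ha 0
    simp only [mulVec, dotProduct, Finset.univ_unique, Fin.default_eq_zero,
      Finset.sum_singleton, Pi.zero_apply, mul_eq_zero, h00, false_or] at h0
    ext i
    rwa [Subsingleton.elim i 0]
  have hUinj := mulVec_injective_of_isUnit hU
  have hPdet : IsUnit P.det := by
    obtain ⟨σ, rfl⟩ := hP
    rw [det_permutation]
    exact (Units.isUnit σ.sign).map (Int.castRingHom ℝ)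
  have hPinj := mulVec_injective_of_isUnit
    ((isUnit_nonsing_inv_iff).2 ((isUnit_iff_isUnit_det P).2 hPdet))
  have hsolve : ∀ w, (l • E + A) *ᵥ (((l • E + A)⁻¹ * E) *ᵥ w) = E *ᵥ w := fun w => by
    rw [mulVec_mulVec, mul_nonsing_inv_cancel_left _ _ ((isUnit_iff_isUnit_det _).1 hC)]
  have hEx := hsolve (((l • E + A)⁻¹ * E) *ᵥ v)
  rw [hv, mulVec_zero] at hEx
  have hAx := hsolve v
  generalize ((l • E + A)⁻¹ * E) *ᵥ v = x at hEx hAx ⊢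
  rw [add_mulVec, smul_mulVec, ← hEx, smul_zero, zero_add, hA, hE, ← mulVec_mulVec,
    ← mulVec_mulVec, ← mulVec_mulVec, ← mulVec_mulVec] at hAx
  have hAx' := hUinj hAx
  rw [hE, ← mulVec_mulVec, ← mulVec_mulVec] at hEx
  have hEx' := hUinj ((mulVec_zero U).trans hEx)
  rw [fromBlocks_mulVec] at hEx'
  rw [fromBlocks_mulVec, fromBlocks_mulVec] at hAx'
  have h₁ : S *ᵥ ((P⁻¹ *ᵥ x) ∘ Sum.inl) + T *ᵥ ((P⁻¹ *ᵥ x) ∘ Sum.inr) = 0 :=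
    funext fun i => (congrFun hEx' (Sum.inl i)).symm
  have h₂ : M *ᵥ ((P⁻¹ *ᵥ x) ∘ Sum.inl) + N *ᵥ ((P⁻¹ *ᵥ x) ∘ Sum.inr) = 0 :=
    funext fun i => by simpa using congrFun hAx' (Sum.inr i)
  obtain ⟨ha, hb⟩ := eq_zero_of_schur_mulVec_injective hN hinj h₁ h₂
  apply hPinj
  rw [mulVec_zero]
  ext (i | i)
  · exact congrFun ha i
  · exact congrFun hb i
end

section
/- Let n be a natural number and let E, A ∈ ℝ^{n×n} be such that λ•E + A is invertible for some λ ∈ ℝ. Then the index of (λ•E + A)⁻¹ * E (the Kronecker index of the pencil (E, A)) is at most rank(E) + 1. -/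
open Matrix

theorem rank_pow_succ_lt_of_lt_matIndex {ι : Type*} [Fintype ι] [DecidableEq ι]
    (B : Matrix ι ι ℝ) {k : ℕ} (hk : k < matIndex B) :
    (B ^ (k + 1)).rank < (B ^ k).rank := by
  have hne : LinearMap.ker (B ^ k).mulVecLin ≠ LinearMap.ker (B ^ (k + 1)).mulVecLin :=
    Nat.notMem_of_lt_sInf hk
  have hle : LinearMap.ker (B ^ k).mulVecLin ≤ LinearMap.ker (B ^ (k + 1)).mulVecLin := by
    rw [pow_succ', Matrix.mulVecLin_mul]
    exact LinearMap.ker_le_ker_comp _ _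
  have hlt := Submodule.finrank_lt_finrank_of_lt (lt_of_le_of_ne hle hne)
  have hk := LinearMap.finrank_range_add_finrank_ker (B ^ k).mulVecLin
  have hk' := LinearMap.finrank_range_add_finrank_ker (B ^ (k + 1)).mulVecLin
  unfold Matrix.rank
  omega

theorem rank_pow_succ_add_le_of_lt_matIndex {ι : Type*} [Fintype ι] [DecidableEq ι]
    (B : Matrix ι ι ℝ) {k : ℕ} (hk : k < matIndex B) :
    (B ^ (k + 1)).rank + k ≤ B.rank := by
  induction k with
  | zero => simp
  | succ k ih =>
    have hstep := rank_pow_succ_lt_of_lt_matIndex B hk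
    have := ih (by omega)
    omega

theorem matIndex_le_rank_succ {ι : Type*} [Fintype ι] [DecidableEq ι]
    (B : Matrix ι ι ℝ) : matIndex B ≤ B.rank + 1 := by
  by_contra! h
  have := rank_pow_succ_add_le_of_lt_matIndex B h
  omega

/-- The Kronecker index of a regular pencil `(E, A)` is at most `rank E + 1`. -/
theorem kronecker_index_le_rank_succ (n : ℕ) (E A : Matrix (Fin n) (Fin n) ℝ)
    (l : ℝ) (hC : IsUnit (l • E + A)) :
    matIndex ((l • E + A)⁻¹ * E) ≤ E.rank + 1 :=
  (matIndex_le_rank_succ _).trans (Nat.succ_le_succ (Matrix.rank_mul_le_right _ _))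
end

section
/- Let r, m be natural numbers with m ≥ 1 and n = r + m (identify Fin n with Fin r ⊕ Fin m). Let E, A ∈ ℝ^{n×n}, U ∈ ℝ^{n×n} invertible, P an n×n permutation matrix, S, K ∈ ℝ^{r×r}, T, L ∈ ℝ^{r×m}, M ∈ ℝ^{m×r}, N ∈ ℝ^{m×m} invertible, with E = U * (fromBlocks S T 0 0) * P⁻¹ and A = U * (fromBlocks K L M N) * P⁻¹. Set E₁ = S − T*N⁻¹*M and A₁ = K − L*N⁻¹*M. Let I ⊆ ℝ be an open interval, f : I → ℝ^n, and write U⁻¹·f(t) = (g(t), h(t)) ∈ ℝ^r × ℝ^m, where h is differentiable on I. Let x : I → ℝ^n be differentiable, and write P⁻¹·x(t) = (u(t), v(t)) ∈ ℝ^r × ℝ^m. Then x satisfies E·x′(t) = A·x(t) + f(t) for all t ∈ I if and only if for all t ∈ I: E₁·u′(t) = A₁·u(t) + T·N⁻¹·h′(t) − L·N⁻¹·h(t) + g(t) and v(t) = −N⁻¹·M·u(t) − N⁻¹·h(t). -/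
open Matrix

theorem Matrix.mulVec_eq_iff_eq_inv_mulVec {n R : Type*} [Fintype n] [DecidableEq n] [CommRing R]
    {U : Matrix n n R} (hU : IsUnit U) (a b : n → R) : U *ᵥ a = b ↔ a = U⁻¹ *ᵥ b := by
  have hdet := (isUnit_iff_isUnit_det U).1 hU
  constructor
  · rintro rfl
    rw [mulVec_mulVec, nonsing_inv_mul U hdet, one_mulVec]
  · rintro rfl
    rw [mulVec_mulVec, mul_nonsing_inv U hdet, one_mulVec]

theorem HasDerivAt.matrix_mulVec {m n : Type*} [Fintype m] [Fintype n] (B : Matrix m n ℝ)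
    {y : ℝ → n → ℝ} {y' : n → ℝ} {t : ℝ} (hy : HasDerivAt y y' t) :
    HasDerivAt (fun s => B *ᵥ y s) (B *ᵥ y') t :=
  (LinearMap.toContinuousLinearMap B.mulVecLin).hasFDerivAt.comp_hasDerivAt t hy

/-- In the coordinates `Q x = (u, v)`, `Q x' = (p, q)`, `U⁻¹ f = (g, h)`, the equation
`E x' = A x + f` splits into a differential and an algebraic block row. -/
theorem Matrix.block_descriptor_eq_iff {r m R : Type*} [Fintype r] [Fintype m] [DecidableEq r]
    [DecidableEq m] [CommRing R] {U Q : Matrix (r ⊕ m) (r ⊕ m) R} (hU : IsUnit U)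
    (S K : Matrix r r R) (T L : Matrix r m R) (M : Matrix m r R) (N : Matrix m m R)
    {x x' f : r ⊕ m → R} {u p g : r → R} {v q h : m → R}
    (hf : U⁻¹ *ᵥ f = Sum.elim g h) (hx : Q *ᵥ x = Sum.elim u v) (hx' : Q *ᵥ x' = Sum.elim p q) :
    (U * fromBlocks S T 0 0 * Q) *ᵥ x' = (U * fromBlocks K L M N * Q) *ᵥ x + f ↔
      S *ᵥ p + T *ᵥ q = K *ᵥ u + L *ᵥ v + g ∧ M *ᵥ u + N *ᵥ v + h = 0 := by
  have hdet := (isUnit_iff_isUnit_det U).1 hU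
  rw [← mulVec_mulVec, ← mulVec_mulVec, ← mulVec_mulVec, ← mulVec_mulVec, hx, hx',
    mulVec_eq_iff_eq_inv_mulVec hU, mulVec_add, hf, mulVec_mulVec, nonsing_inv_mul U hdet,
    one_mulVec, fromBlocks_mulVec, fromBlocks_mulVec, ← Sum.elim_add_add, Sum.elim_eq_iff]
  simp [eq_comm]

/-- Equivalence of the linear time-invariant DAE `E x' = A x + f` with the deflated
DAE `E₁ u' = A₁ u + T N⁻¹ h' - L N⁻¹ h + g` together with the algebraic constraint
`v = -N⁻¹ M u - N⁻¹ h`, where `P⁻¹ x = (u, v)` and `U⁻¹ f = (g, h)`. -/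
theorem deflation_dae_equivalence (r m : ℕ) (hm : 1 ≤ m)
    (E A U : Matrix (Fin r ⊕ Fin m) (Fin r ⊕ Fin m) ℝ) (hU : IsUnit U)
    (P : Matrix (Fin r ⊕ Fin m) (Fin r ⊕ Fin m) ℝ)
    (hP : ∃ σ : Equiv.Perm (Fin r ⊕ Fin m), P = σ.permMatrix ℝ)
    (S K : Matrix (Fin r) (Fin r) ℝ) (T L : Matrix (Fin r) (Fin m) ℝ)
    (M : Matrix (Fin m) (Fin r) ℝ) (N : Matrix (Fin m) (Fin m) ℝ)
    (hN : IsUnit N)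
    (hE : E = U * fromBlocks S T 0 0 * P⁻¹)
    (hA : A = U * fromBlocks K L M N * P⁻¹)
    (E₁ A₁ : Matrix (Fin r) (Fin r) ℝ)
    (hE₁ : E₁ = S - T * N⁻¹ * M) (hA₁ : A₁ = K - L * N⁻¹ * M)
    (I : Set ℝ) (hI : ∃ a b : ℝ, I = Set.Ioo a b)
    (f : ℝ → Fin r ⊕ Fin m → ℝ)
    (g : ℝ → Fin r → ℝ) (h : ℝ → Fin m → ℝ)
    (hf : ∀ t ∈ I, U⁻¹.mulVec (f t) = Sum.elim (g t) (h t))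
    (h' : ℝ → Fin m → ℝ) (hh : ∀ t ∈ I, HasDerivAt h (h' t) t)
    (x x' : ℝ → Fin r ⊕ Fin m → ℝ) (hx : ∀ t ∈ I, HasDerivAt x (x' t) t)
    (u u' : ℝ → Fin r → ℝ) (v : ℝ → Fin m → ℝ)
    (hxuv : ∀ t ∈ I, P⁻¹.mulVec (x t) = Sum.elim (u t) (v t))
    (hu : ∀ t ∈ I, HasDerivAt u (u' t) t) :
    (∀ t ∈ I, E.mulVec (x' t) = A.mulVec (x t) + f t) ↔
      (∀ t ∈ I,
        E₁.mulVec (u' t) =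
          A₁.mulVec (u t) + (T * N⁻¹).mulVec (h' t) - (L * N⁻¹).mulVec (h t) + g t ∧
        v t = -((N⁻¹ * M).mulVec (u t)) - N⁻¹.mulVec (h t)) := by
  subst hE hA hE₁ hA₁
  have hopen : IsOpen I := by
    obtain ⟨a, b, rfl⟩ := hI
    exact isOpen_Ioo
  set q : ℝ → Fin m → ℝ := fun t j => (P⁻¹ *ᵥ x' t) (Sum.inr j)
  have hderiv : ∀ t ∈ I, HasDerivAt (fun s => Sum.elim (u s) (v s)) (P⁻¹ *ᵥ x' t) t := by
    intro t ht
    refine ((hx t ht).matrix_mulVec P⁻¹).congr_of_eventuallyEq ?_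
    filter_upwards [hopen.mem_nhds ht] with s hs using (hxuv s hs).symm
  have hv : ∀ t ∈ I, HasDerivAt v (q t) t := fun t ht =>
    hasDerivAt_pi.2 fun j => hasDerivAt_pi.1 (hderiv t ht) (Sum.inr j)
  have hx' : ∀ t ∈ I, P⁻¹ *ᵥ x' t = Sum.elim (u' t) (q t) := by
    intro t ht
    funext i
    cases i with
    | inl i =>
      exact (hasDerivAt_pi.1 (hderiv t ht) (Sum.inl i)).unique (hasDerivAt_pi.1 (hu t ht) i)
    | inr j => rfl
  have hsplit := fun t ht => block_descriptor_eq_iff hU S K T L M N (hf t ht) (hxuv t ht) (hx' t ht)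
  have halg : ∀ t, M *ᵥ u t + N *ᵥ v t + h t = 0 ↔
      v t = -((N⁻¹ * M) *ᵥ u t) - N⁻¹ *ᵥ h t := by
    intro t
    rw [show -((N⁻¹ * M) *ᵥ u t) - N⁻¹ *ᵥ h t = N⁻¹ *ᵥ (-(M *ᵥ u t) - h t) by
      rw [mulVec_sub, mulVec_neg, mulVec_mulVec], ← mulVec_eq_iff_eq_inv_mulVec hN]
    constructor <;> intro e
    · linear_combination e
    · linear_combination e
  have hdiff : (∀ t ∈ I, v t = -((N⁻¹ * M) *ᵥ u t) - N⁻¹ *ᵥ h t) →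
      ∀ t ∈ I, q t = -((N⁻¹ * M) *ᵥ u' t) - N⁻¹ *ᵥ h' t := by
    intro hvI t ht
    refine (hv t ht).unique (HasDerivAt.congr_of_eventuallyEq
      (((hu t ht).matrix_mulVec (N⁻¹ * M)).neg.sub ((hh t ht).matrix_mulVec N⁻¹)) ?_)
    filter_upwards [hopen.mem_nhds ht] with s hs using hvI s hs
  have hrow : ∀ t, v t = -((N⁻¹ * M) *ᵥ u t) - N⁻¹ *ᵥ h t →
      q t = -((N⁻¹ * M) *ᵥ u' t) - N⁻¹ *ᵥ h' t →
      (S *ᵥ u' t + T *ᵥ q t = K *ᵥ u t + L *ᵥ v t + g t ↔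
        (S - T * N⁻¹ * M) *ᵥ u' t = (K - L * N⁻¹ * M) *ᵥ u t + (T * N⁻¹) *ᵥ h' t
          - (L * N⁻¹) *ᵥ h t + g t) := by
    intro t hvt hqt
    rw [hvt, hqt]
    simp only [sub_mulVec, mulVec_sub, mulVec_neg, mulVec_mulVec, Matrix.mul_assoc]
    constructor <;> intro e
    · linear_combination e
    · linear_combination e
  constructor
  · intro hdae
    have hvI : ∀ t ∈ I, v t = -((N⁻¹ * M) *ᵥ u t) - N⁻¹ *ᵥ h t := fun t ht =>
      (halg t).1 ((hsplit t ht).1 (hdae t ht)).2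
    exact fun t ht => ⟨(hrow t (hvI t ht) (hdiff hvI t ht)).1 ((hsplit t ht).1 (hdae t ht)).1,
      hvI t ht⟩
  · intro hdef t ht
    have hvI := fun t ht => (hdef t ht).2
    exact (hsplit t ht).2
      ⟨(hrow t (hvI t ht) (hdiff hvI t ht)).2 (hdef t ht).1, (halg t).2 (hvI t ht)⟩
end

section
/- Let r, m be natural numbers with m ≥ 1 and n = r + m (identify Fin n with Fin r ⊕ Fin m), and let I ⊆ ℝ be an open interval. Let U : I → ℝ^{n×n} with U(t) invertible for all t ∈ I, P an n×n (constant) permutation matrix, and let S, K : I → ℝ^{r×r}, T, L : I → ℝ^{r×m}, M : I → ℝ^{m×r}, N : I → ℝ^{m×m} with N(t) invertible for all t ∈ I, where M and N are differentiable on I. Define E(t) = U(t) * (fromBlocks (S t) (T t) 0 0) * P⁻¹ and A(t) = U(t) * (fromBlocks (K t) (L t) (M t) (N t)) * P⁻¹. Let f : I → ℝ^n and write U(t)⁻¹·f(t) = (g(t), h(t)) ∈ ℝ^r × ℝ^m with h differentiable on I. Define E₁(t) = S(t) − T(t)*N(t)⁻¹*M(t), A₁(t) = K(t) − L(t)*N(t)⁻¹*M(t)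 + T(t)*N(t)⁻¹*(M′(t) − N′(t)*N(t)⁻¹*M(t)), and f₁(t) = T(t)*N(t)⁻¹*(h′(t) − N′(t)*N(t)⁻¹*h(t)) − L(t)*N(t)⁻¹*h(t) + g(t). If x : I → ℝ^n is differentiable and satisfies E(t)·x′(t) = A(t)·x(t) + f(t) for all t ∈ I, and P⁻¹·x(t) = (u(t), v(t)) ∈ ℝ^r × ℝ^m, then for all t ∈ I: E₁(t)·u′(t) = A₁(t)·u(t) + f₁(t) and v(t) = −N(t)⁻¹·(M(t)·u(t) + h(t)). -/
open Matrix

/-- Entrywise product rule for the product of a matrix and a vector. -/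
theorem hasDerivAt_mulVec_apply {ι κ : Type*} [Fintype κ] {B : ℝ → Matrix ι κ ℝ}
    {w : ℝ → κ → ℝ} {B' : Matrix ι κ ℝ} {w' : κ → ℝ} {t : ℝ} (i : ι)
    (hB : ∀ j, HasDerivAt (fun s => B s i j) (B' i j) t)
    (hw : ∀ j, HasDerivAt (fun s => w s j) (w' j) t) :
    HasDerivAt (fun s => (B s).mulVec (w s) i) ((B'.mulVec (w t) + (B t).mulVec w') i) t := by
  refine (HasDerivAt.fun_sum (u := Finset.univ) fun j _ =>
    (hB j).fun_mul (hw j)).congr_deriv ?_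
  simp [mulVec, dotProduct, Finset.sum_add_distrib]

/-- A solution of `U [[S, T], [0, 0]] y' = U [[K, L], [M, N]] y + f`, with `y = (u, v)`,
`y' = (u', v')` and `U⁻¹ f = (g, h)`, satisfies a differential and an algebraic block equation. -/
theorem block_equations {ι κ : Type*} [Fintype ι] [Fintype κ] [DecidableEq ι] [DecidableEq κ]
    {U : Matrix (ι ⊕ κ) (ι ⊕ κ) ℝ} (hU : IsUnit U) {S K : Matrix ι ι ℝ} {T L : Matrix ι κ ℝ}
    {M : Matrix κ ι ℝ} {N : Matrix κ κ ℝ} {f : ι ⊕ κ → ℝ} {u u' g : ι → ℝ} {v v' h : κ → ℝ}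
    (hf : U⁻¹.mulVec f = Sum.elim g h)
    (hsol : U.mulVec ((fromBlocks S T 0 0).mulVec (Sum.elim u' v')) =
      U.mulVec ((fromBlocks K L M N).mulVec (Sum.elim u v)) + f) :
    S.mulVec u' + T.mulVec v' = K.mulVec u + L.mulVec v + g ∧
      M.mulVec u + N.mulVec v + h = 0 := by
  have hdet : IsUnit U.det := (isUnit_iff_isUnit_det U).mp hU
  have key := congrArg (U⁻¹.mulVec ·) hsol
  simp only [mulVec_add, mulVec_mulVec, nonsing_inv_mul _ hdet, one_mulVec, hf,
    fromBlocks_mulVec, Sum.elim_comp_inl, Sum.elim_comp_inr, zero_mulVec, add_zero] at key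
  constructor
  · ext i
    simpa using congrFun key (Sum.inl i)
  · ext i
    simpa using (congrFun key (Sum.inr i)).symm

/-- One step of deflation for a linear time-varying DAE: if `x` solves
`E(t) x' = A(t) x + f(t)` on the open interval `I`, where
`E(t) = U(t) [[S, T], [0, 0]] P⁻¹`, `A(t) = U(t) [[K, L], [M, N]] P⁻¹`,
`U(t)⁻¹ f(t) = (g(t), h(t))` and `P⁻¹ x(t) = (u(t), v(t))`, then `u` solves the
deflated DAE `E₁(t) u' = A₁(t) u + f₁(t)` and the algebraic constraint
`v = -N⁻¹ (M u + h)` holds on `I`. -/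
theorem deflation_time_varying (r m : ℕ) (hm : 1 ≤ m)
    (I : Set ℝ) (hI : ∃ a b : ℝ, I = Set.Ioo a b)
    (U : ℝ → Matrix (Fin r ⊕ Fin m) (Fin r ⊕ Fin m) ℝ)
    (hU : ∀ t ∈ I, IsUnit (U t))
    (P : Matrix (Fin r ⊕ Fin m) (Fin r ⊕ Fin m) ℝ)
    (hP : ∃ σ : Equiv.Perm (Fin r ⊕ Fin m), P = σ.permMatrix ℝ)
    (S K : ℝ → Matrix (Fin r) (Fin r) ℝ) (T L : ℝ → Matrix (Fin r) (Fin m) ℝ)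
    (M : ℝ → Matrix (Fin m) (Fin r) ℝ) (N : ℝ → Matrix (Fin m) (Fin m) ℝ)
    (hN : ∀ t ∈ I, IsUnit (N t))
    (M' : ℝ → Matrix (Fin m) (Fin r) ℝ)
    (hM : ∀ t ∈ I, ∀ i j, HasDerivAt (fun s => M s i j) (M' t i j) t)
    (N' : ℝ → Matrix (Fin m) (Fin m) ℝ)
    (hN' : ∀ t ∈ I, ∀ i j, HasDerivAt (fun s => N s i j) (N' t i j) t)
    (E A : ℝ → Matrix (Fin r ⊕ Fin m) (Fin r ⊕ Fin m) ℝ)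
    (hE : ∀ t ∈ I, E t = U t * fromBlocks (S t) (T t) 0 0 * P⁻¹)
    (hA : ∀ t ∈ I, A t = U t * fromBlocks (K t) (L t) (M t) (N t) * P⁻¹)
    (f : ℝ → Fin r ⊕ Fin m → ℝ)
    (g : ℝ → Fin r → ℝ) (h : ℝ → Fin m → ℝ)
    (hf : ∀ t ∈ I, (U t)⁻¹.mulVec (f t) = Sum.elim (g t) (h t))
    (h' : ℝ → Fin m → ℝ) (hh : ∀ t ∈ I, ∀ i, HasDerivAt (fun s => h s i) (h' t i) t)
    (E₁ A₁ : ℝ → Matrix (Fin r) (Fin r) ℝ) (f₁ : ℝ → Fin r → ℝ)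
    (hE₁ : ∀ t ∈ I, E₁ t = S t - T t * (N t)⁻¹ * M t)
    (hA₁ : ∀ t ∈ I, A₁ t =
      K t - L t * (N t)⁻¹ * M t + T t * (N t)⁻¹ * (M' t - N' t * (N t)⁻¹ * M t))
    (hf₁ : ∀ t ∈ I, f₁ t =
      (T t * (N t)⁻¹).mulVec (h' t - (N' t * (N t)⁻¹).mulVec (h t)) -
        (L t * (N t)⁻¹).mulVec (h t) + g t)
    (x x' : ℝ → Fin r ⊕ Fin m → ℝ) (hx : ∀ t ∈ I, ∀ i, HasDerivAt (fun s => x s i) (x' t i) t)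
    (u u' : ℝ → Fin r → ℝ) (v : ℝ → Fin m → ℝ)
    (hxuv : ∀ t ∈ I, P⁻¹.mulVec (x t) = Sum.elim (u t) (v t))
    (hu : ∀ t ∈ I, ∀ i, HasDerivAt (fun s => u s i) (u' t i) t)
    (hsol : ∀ t ∈ I, (E t).mulVec (x' t) = (A t).mulVec (x t) + f t) :
    ∀ t ∈ I,
      (E₁ t).mulVec (u' t) = (A₁ t).mulVec (u t) + f₁ t ∧
      v t = -((N t)⁻¹.mulVec ((M t).mulVec (u t) + h t)) := by
  have hopen : IsOpen I := by
    obtain ⟨a, b, rfl⟩ := hI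
    exact isOpen_Ioo
  intro t ht
  have hPx (i) : HasDerivAt (fun s => P⁻¹.mulVec (x s) i) (P⁻¹.mulVec (x' t) i) t := by
    simpa using hasDerivAt_mulVec_apply (B := fun _ => P⁻¹) (B' := 0) i
      (fun j => hasDerivAt_const t (P⁻¹ i j)) (hx t ht)
  let v' : Fin m → ℝ := fun j => P⁻¹.mulVec (x' t) (Sum.inr j)
  have hv (j) : HasDerivAt (fun s => v s j) (v' j) t := by
    refine (hPx (Sum.inr j)).congr_of_eventuallyEq ?_
    filter_upwards [hopen.mem_nhds ht] with s hs
    simp [hxuv s hs]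
  have hPx' : P⁻¹.mulVec (x' t) = Sum.elim (u' t) v' := by
    ext (i | j)
    · refine (hPx (Sum.inl i)).unique ((hu t ht i).congr_of_eventuallyEq ?_)
      filter_upwards [hopen.mem_nhds ht] with s hs
      simp [hxuv s hs]
    · rfl
  have hblock (s) (hs : s ∈ I) :
      (S s).mulVec (P⁻¹.mulVec (x' s) ∘ Sum.inl) + (T s).mulVec (P⁻¹.mulVec (x' s) ∘ Sum.inr) =
        (K s).mulVec (u s) + (L s).mulVec (v s) + g s ∧
      (M s).mulVec (u s) + (N s).mulVec (v s) + h s = 0 := by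
    refine block_equations (hU s hs) (hf s hs) ?_
    rw [Sum.elim_comp_inl_inr, ← hxuv s hs]
    simpa only [hE s hs, hA s hs, ← mulVec_mulVec] using hsol s hs
  have hdiff := (hblock t ht).1
  rw [hPx', Sum.elim_comp_inl, Sum.elim_comp_inr] at hdiff
  have hhidden : (M' t).mulVec (u t) + (M t).mulVec (u' t) +
      ((N' t).mulVec (v t) + (N t).mulVec v') + h' t = 0 := by
    ext i
    refine (((hasDerivAt_mulVec_apply i (hM t ht i) (hu t ht)).add
      (hasDerivAt_mulVec_apply i (hN' t ht i) hv)).add (hh t ht i)).unique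
      ((hasDerivAt_const t (0 : ℝ)).congr_of_eventuallyEq ?_)
    filter_upwards [hopen.mem_nhds ht] with s hs
    exact congrFun (hblock s hs).2 i
  have hdet : IsUnit (N t).det := (isUnit_iff_isUnit_det _).mp (hN t ht)
  have hsolve {w c : Fin m → ℝ} (hw : (N t).mulVec w = -c) : w = -((N t)⁻¹.mulVec c) := by
    rw [← mulVec_neg, ← hw, mulVec_mulVec, nonsing_inv_mul _ hdet, one_mulVec]
  have hvt : v t = -((N t)⁻¹.mulVec ((M t).mulVec (u t) + h t)) :=
    hsolve (by linear_combination (hblock t ht).2)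
  have hvt' : v' = -((N t)⁻¹.mulVec ((M' t).mulVec (u t) + (M t).mulVec (u' t) +
      (N' t).mulVec (v t) + h' t)) :=
    hsolve (by linear_combination hhidden)
  refine ⟨?_, hvt⟩
  rw [hvt', hvt] at hdiff
  rw [hE₁ t ht, hA₁ t ht, hf₁ t ht]
  simp only [← mulVec_mulVec, add_mulVec, sub_mulVec, mulVec_add, mulVec_sub, mulVec_neg]
    at hdiff ⊢
  linear_combination hdiff
end
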